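/- Let D₁ ⊆ D₂ be two domains in ℂⁿ and ψ an upper semi-continuous real-valued function on D₂. Assume there is a subset E ⊆ D₂ that is closed in D₂ and pluripolar in D₂, with D₂ = D₁ ∪ E. Then (D₁, ψ restricted to D₁) is L²-optimal if and only if (D₂, ψ) is L²-optimal. -/

import Mathlib

open MeasureTheory Matrix Filter Topology
open scoped ENNReal ComplexOrder

noncomputable section

/-- The Wirtinger derivative `∂u/∂z̄ⱼ = (1/2)(∂u/∂xⱼ + i ∂u/∂yⱼ)` of `u : ℂⁿ → ℂ`. -/
def dbarCoord {n : ℕ} (u : (Fin n → ℂ) → ℂ) (j : Fin n) (z : Fin n → ℂ) : ℂ :=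
  (1 / 2 : ℂ) *
    (fderiv ℝ u z (Pi.single j 1) + Complex.I * fderiv ℝ u z (Pi.single j Complex.I))

/-- The Wirtinger derivative `∂u/∂zⱼ = (1/2)(∂u/∂xⱼ − i ∂u/∂yⱼ)` of `u : ℂⁿ → ℂ`. -/
def dzCoord {n : ℕ} (u : (Fin n → ℂ) → ℂ) (j : Fin n) (z : Fin n → ℂ) : ℂ :=
  (1 / 2 : ℂ) *
    (fderiv ℝ u z (Pi.single j 1) - Complex.I * fderiv ℝ u z (Pi.single j Complex.I))

/-- `χ ∈ C_c^∞(D)`: a smooth compactly supported function with support inside `D`. -/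
def IsTestFunOn {n : ℕ} (D : Set (Fin n → ℂ)) (χ : (Fin n → ℂ) → ℂ) : Prop :=
  ContDiff ℝ (⊤ : ℕ∞) χ ∧ HasCompactSupport χ ∧ tsupport χ ⊆ D

/-- The `(0,1)`-form `f = Σ fⱼ dz̄ⱼ` is `∂̄`-closed on `D` in the distributional sense. -/
def DbarClosedOn {n : ℕ} (D : Set (Fin n → ℂ)) (f : Fin n → (Fin n → ℂ) → ℂ) : Prop :=
  ∀ i j : Fin n, ∀ χ : (Fin n → ℂ) → ℂ, IsTestFunOn D χ →
    ∫ z in D, (f i z * dbarCoord χ j z - f j z * dbarCoord χ i z) = 0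

/-- `∂̄u = f` on `D` in the distributional sense. -/
def DbarEqOn {n : ℕ} (D : Set (Fin n → ℂ)) (u : (Fin n → ℂ) → ℂ)
    (f : Fin n → (Fin n → ℂ) → ℂ) : Prop :=
  ∀ j : Fin n, ∀ χ : (Fin n → ℂ) → ℂ, IsTestFunOn D χ →
    ∫ z in D, u z * dbarCoord χ j z = -∫ z in D, f j z * χ z

/-- `∫_D |u|² e^{−w} dλ` as an extended nonnegative real. -/
def eL2 {n : ℕ} (D : Set (Fin n → ℂ)) (w : (Fin n → ℂ) → ℝ) (u : (Fin n → ℂ) → ℂ) : ℝ≥0∞ :=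
  ∫⁻ z in D, ENNReal.ofReal (‖u z‖ ^ 2 * Real.exp (-w z))

/-- `∫_D Σⱼ|fⱼ|² e^{−w} dλ` for a `(0,1)`-form `f = Σ fⱼ dz̄ⱼ`. -/
def eL2form {n : ℕ} (D : Set (Fin n → ℂ)) (w : (Fin n → ℂ) → ℝ)
    (f : Fin n → (Fin n → ℂ) → ℂ) : ℝ≥0∞ :=
  ∫⁻ z in D, ENNReal.ofReal ((∑ j, ‖f j z‖ ^ 2) * Real.exp (-w z))

/-- The complex Hessian matrix `(∂²φ/∂zᵢ∂z̄ⱼ(z))` of `φ : ℂⁿ → ℝ`. -/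
def complexHessian {n : ℕ} (φ : (Fin n → ℂ) → ℝ) (z : Fin n → ℂ) :
    Matrix (Fin n) (Fin n) ℂ :=
  Matrix.of fun i j => dbarCoord (fun y => dzCoord (fun v => (φ v : ℂ)) i y) j z

/-- `φ : ℂⁿ → ℝ` is smooth and strictly plurisubharmonic (positive definite complex Hessian). -/
def SmoothStrictlyPSH {n : ℕ} (φ : (Fin n → ℂ) → ℝ) : Prop :=
  ContDiff ℝ (⊤ : ℕ∞) φ ∧ ∀ z, (complexHessian φ z).PosDef

/-- `⟨B_φ⁻¹ f, f⟩(z)`: the Hermitian form of the inverse complex Hessian of `φ`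
applied to the coefficient vector of `f`. -/
def Bform {n : ℕ} (φ : (Fin n → ℂ) → ℝ) (f : Fin n → (Fin n → ℂ) → ℂ) (z : Fin n → ℂ) : ℝ :=
  (star (fun i => f i z) ⬝ᵥ (complexHessian φ z)⁻¹.mulVec fun i => f i z).re

/-- The pair `(D, ψ)` is `L²`-optimal. -/
def L2OptimalPair {n : ℕ} (D : Set (Fin n → ℂ)) (ψ : (Fin n → ℂ) → ℝ) : Prop :=
  ∀ φ : (Fin n → ℂ) → ℝ, SmoothStrictlyPSH φ →
    ∀ f : Fin n → (Fin n → ℂ) → ℂ, (∀ j, Measurable (f j)) →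
      eL2form D (fun z => φ z + ψ z) f < ⊤ → DbarClosedOn D f →
      (∫⁻ z in D, ENNReal.ofReal (Bform φ f z * Real.exp (-(φ z + ψ z)))) < ⊤ →
      ∃ u : (Fin n → ℂ) → ℂ, Measurable u ∧ DbarEqOn D u f ∧
        eL2 D (fun z => φ z + ψ z) u ≤
          ∫⁻ z in D, ENNReal.ofReal (Bform φ f z * Real.exp (-(φ z + ψ z)))

/-- The domain `D` is `L²`-optimal. -/
def L2Optimal {n : ℕ} (D : Set (Fin n → ℂ)) : Prop :=
  L2OptimalPair D fun _ => 0

/-- `D` is an `L²`-domain of holomorphy. -/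
def L2DomainOfHolomorphy {n : ℕ} (D : Set (Fin n → ℂ)) : Prop :=
  ∀ U₁ U₂ : Set (Fin n → ℂ), IsOpen U₁ → IsOpen U₂ → U₁.Nonempty → U₁ ⊆ D ∩ U₂ →
    D ∩ U₂ ≠ U₂ → IsConnected U₂ →
    ∃ f : (Fin n → ℂ) → ℂ, DifferentiableOn ℂ f D ∧ eL2 D (fun _ => 0) f < ⊤ ∧
      ∀ F : (Fin n → ℂ) → ℂ, DifferentiableOn ℂ F U₂ → ¬Set.EqOn F f U₁

/-- Truncation of an extended real to an extended nonnegative real. -/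
def erealToENNReal (x : EReal) : ℝ≥0∞ :=
  if x = ⊤ then ⊤ else ENNReal.ofReal x.toReal

/-- `v : Ω → [−∞,∞)` is plurisubharmonic on the open set `Ω ⊆ ℂⁿ`: it is upper
semicontinuous, takes values in `[−∞,∞)`, and satisfies the sub-mean value inequality
`v(a) ≤ (1/2π)∫₀^{2π} v(a + re^{iθ}b) dθ` on every closed disc contained in `Ω`.
(The inequality `v a ≤ M − avg(M − v)` is expressed as `v a + avg(M − v) ≤ M` for every
real upper bound `M` of `v` on the circle, which avoids integrating extended-real-valued
functions directly.) -/
def PlurisubharmonicOn {n : ℕ} (v : (Fin n → ℂ) → EReal) (Ω : Set (Fin n → ℂ)) : Prop :=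
  UpperSemicontinuousOn v Ω ∧ (∀ z ∈ Ω, v z < ⊤) ∧
    ∀ a ∈ Ω, ∀ b : Fin n → ℂ, ∀ r : ℝ, 0 < r →
      (∀ τ : ℂ, ‖τ‖ ≤ r → a + τ • b ∈ Ω) →
      ∀ M : ℝ,
        (∀ θ : ℝ, v (a + ((r : ℂ) * Complex.exp (θ * Complex.I)) • b) ≤ (M : EReal)) →
        v a + (((∫⁻ θ in Set.Ioc (0 : ℝ) (2 * Real.pi),
              erealToENNReal ((M : EReal) - v (a + ((r : ℂ) * Complex.exp (θ * Complex.I)) • b))) /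
            ENNReal.ofReal (2 * Real.pi) : ℝ≥0∞) : EReal) ≤ (M : EReal)

/-- `D ⊆ ℂⁿ` is pseudoconvex: either `D = ℂⁿ` or `z ↦ −log dist(z, ℂⁿ∖D)` is
plurisubharmonic on `D`. -/
def Pseudoconvex {n : ℕ} (D : Set (Fin n → ℂ)) : Prop :=
  D = Set.univ ∨
    PlurisubharmonicOn (fun z => ((-Real.log (Metric.infDist z Dᶜ) : ℝ) : EReal)) D

/-- `E` is pluripolar in the open set `Ω`. -/
def PluripolarIn {n : ℕ} (E Ω : Set (Fin n → ℂ)) : Prop :=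
  ∀ x ∈ Ω, ∃ U : Set (Fin n → ℂ), IsOpen U ∧ IsConnected U ∧ x ∈ U ∧ U ⊆ Ω ∧
    ∃ v : (Fin n → ℂ) → EReal, PlurisubharmonicOn v U ∧ (∃ z ∈ U, v z ≠ ⊥) ∧
      ∀ z ∈ E ∩ U, v z = ⊥

section Energy

variable {X : Type*} [NormedAddCommGroup X] [NormedSpace ℝ X]

/-- The symmetric second difference of a compactly supported smooth function is quadratically
small, uniformly in the base point. -/
lemma exists_second_difference_le [FiniteDimensional ℝ X] {η : X → ℝ}
    (hη : ContDiff ℝ (⊤ : ℕ∞) η) (hc : HasCompactSupport η) :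
    ∃ C : ℝ, 0 ≤ C ∧ ∀ a h, |η (a + h) + η (a - h) - 2 * η a| ≤ C * ‖h‖ ^ 2 := by
  have hd : ContDiff ℝ 1 (fderiv ℝ η) := hη.fderiv_right (by norm_cast)
  obtain ⟨C, hC⟩ : ∃ C, LipschitzWith C (fderiv ℝ η) :=
    ⟨_, (hd.lipschitzWith_of_hasCompactSupport (hc.fderiv ℝ) (by simp)).choose_spec⟩
  have hdiff : Differentiable ℝ η := hη.differentiable (by simp)
  refine ⟨2 * C, by positivity, fun a h => ?_⟩
  have key := (convex_closedBall (0 : X) ‖h‖).norm_image_sub_le_of_norm_hasFDerivWithin_le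
    (f := fun y => η (a + y) + η (a - y)) (f' := fun y => fderiv ℝ η (a + y) - fderiv ℝ η (a - y))
    (C := 2 * C * ‖h‖) (x := 0) (y := h) ?_ ?_ (by simp) (by simp)
  · calc |η (a + h) + η (a - h) - 2 * η a|
        = ‖η (a + h) + η (a - h) - (η (a + 0) + η (a - 0))‖ := by
          rw [Real.norm_eq_abs]; congr 1; simp; ring
      _ ≤ 2 * C * ‖h‖ * ‖h - 0‖ := key
      _ = 2 * C * ‖h‖ ^ 2 := by rw [sub_zero]; ring
  · intro y _
    have h1 : HasFDerivAt (fun y => η (a + y)) (fderiv ℝ η (a + y)) y := by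
      have := (hdiff (a + y)).hasFDerivAt.comp y ((hasFDerivAt_id y).const_add a)
      rwa [ContinuousLinearMap.comp_id] at this
    have h2 : HasFDerivAt (fun y => η (a - y)) (-fderiv ℝ η (a - y)) y := by
      have := (hdiff (a - y)).hasFDerivAt.comp y ((hasFDerivAt_id y).const_sub a)
      rwa [ContinuousLinearMap.comp_neg, ContinuousLinearMap.comp_id] at this
    rw [sub_eq_add_neg (fderiv ℝ η (a + y))]
    exact (h1.fun_add h2).hasFDerivWithinAt
  · intro y hy
    have := hC.dist_le_mul (a + y) (a - y)
    rw [dist_eq_norm, dist_eq_norm] at this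
    refine this.trans ?_
    have h2 : a + y - (a - y) = (2 : ℝ) • y := by rw [two_smul]; abel
    rw [h2, norm_smul, Real.norm_eq_abs, abs_two]
    have : ‖y‖ ≤ ‖h‖ := by simpa using hy
    nlinarith [mul_le_mul_of_nonneg_left this C.coe_nonneg]

variable [MeasurableSpace X] [BorelSpace X] [FiniteDimensional ℝ X]
  (μ : Measure X) [μ.IsAddHaarMeasure]

/-- The mean square of a linear form over the unit ball controls its value at unit vectors. -/
lemma exists_sq_apply_le_integral_closedBall :
    ∃ c : ℝ, 0 < c ∧ ∀ (L : X →L[ℝ] ℝ) (e : X), ‖e‖ ≤ 1 →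
      (L e) ^ 2 ≤ c * ∫ b in Metric.closedBall 0 1, (L b) ^ 2 ∂μ := by
  set V : ℝ := μ.real (Metric.closedBall (0 : X) (1 / 2))
  have hV : 0 < V := ENNReal.toReal_pos (Metric.measure_closedBall_pos μ _ (by norm_num)).ne'
    measure_closedBall_lt_top.ne
  refine ⟨4 / V, by positivity, fun L e he => ?_⟩
  have hInt : ∀ r : ℝ, ∀ w : X, IntegrableOn (fun b => (L (b + w)) ^ 2)
      (Metric.closedBall 0 r) μ := fun r w =>
    (Continuous.continuousOn (by fun_prop)).integrableOn_compact (isCompact_closedBall _ _)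
  have shift : ∀ w : X, ‖w‖ ≤ 1 / 2 → ∫ b in Metric.closedBall 0 (1 / 2), (L (b + w)) ^ 2 ∂μ ≤
      ∫ b in Metric.closedBall 0 1, (L b) ^ 2 ∂μ := by
    intro w hw
    have h1 : ∫ b in Metric.closedBall 0 (1 / 2), (L (b + w)) ^ 2 ∂μ =
        ∫ b in Metric.closedBall w (1 / 2), (L b) ^ 2 ∂μ := by
      have := (measurePreserving_add_right μ w).setIntegral_preimage_emb
        (MeasurableEquiv.addRight w).measurableEmbedding (fun b => (L b) ^ 2)
        (Metric.closedBall w (1 / 2))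
      rw [← this]
      congr 2
      ext b
      simp [dist_eq_norm]
    rw [h1]
    refine setIntegral_mono_set (by simpa using hInt 1 0) (ae_of_all _ fun b => sq_nonneg _) ?_
    exact LE.le.eventuallyLE (Metric.closedBall_subset_closedBall' (by
      rw [dist_zero_right]; linarith))
  have hhalf : ‖(1 / 2 : ℝ) • e‖ ≤ 1 / 2 := by
    rw [norm_smul]; norm_num; exact he
  have h1 := shift ((1 / 2 : ℝ) • e) hhalf
  have h2 := shift (-((1 / 2 : ℝ) • e)) (by rwa [norm_neg])
  have h3 : V * ((L e) ^ 2 / 2) ≤ (∫ b in Metric.closedBall 0 (1 / 2),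
      (L (b + (1 / 2 : ℝ) • e)) ^ 2 ∂μ) +
      ∫ b in Metric.closedBall 0 (1 / 2), (L (b + -((1 / 2 : ℝ) • e))) ^ 2 ∂μ := by
    rw [← integral_add (hInt _ _) (hInt _ _)]
    have hconst : V * ((L e) ^ 2 / 2) =
        ∫ _ in Metric.closedBall (0 : X) (1 / 2), (L e) ^ 2 / 2 ∂μ := by simp [V]
    rw [hconst]
    refine integral_mono (integrableOn_const measure_closedBall_lt_top.ne)
      ((hInt _ _).add (hInt _ _)) fun b => ?_
    simp only [map_add, map_neg, map_smul, smul_eq_mul]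
    nlinarith [sq_nonneg (L b)]
  rw [div_mul_eq_mul_div, le_div_iff₀ hV]
  linarith

end Energy

section Caccioppoli

variable {X : Type*} [NormedAddCommGroup X] [NormedSpace ℝ X]
variable [MeasurableSpace X] [BorelSpace X] [FiniteDimensional ℝ X]
  (μ : Measure X) [μ.IsAddHaarMeasure]

/-- Translating against a smooth weight costs only a quadratically small error once averaged over
a symmetric ball. -/
lemma integral_translate_sub_le {η q : X → ℝ} {C : ℝ} (hη : Continuous η)
    (hηc : HasCompactSupport η) (hq : Continuous q) (hqc : HasCompactSupport q)
    (hC : ∀ a h, |η (a + h) + η (a - h) - 2 * η a| ≤ C * ‖h‖ ^ 2) (hC0 : 0 ≤ C) (r : ℝ) :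
    ∫ a, η a * ∫ b in Metric.closedBall 0 1, (q (a + r • b) - q a) ∂μ ∂μ ≤
      μ.real (Metric.closedBall (0 : X) 1) * (C * r ^ 2 * ∫ a, |q a| ∂μ) := by
  set B : Set X := Metric.closedBall 0 1
  have hBfin : μ B < ⊤ := measure_closedBall_lt_top
  have : IsFiniteMeasure (μ.restrict B) := ⟨by simpa using hBfin⟩
  obtain ⟨M, hM⟩ := hqc.exists_bound_of_continuous hq
  set J : X → ℝ := fun b => ∫ a, η a * (q (a + r • b) - q a) ∂μ with hJ
  have hprod : Integrable (fun p : X × X => η p.1 * (q (p.1 + r • p.2) - q p.1))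
      (μ.prod (μ.restrict B)) := by
    refine ((hη.integrable_of_hasCompactSupport (μ := μ) hηc).mul_prod
      (integrable_const (μ := μ.restrict B) (2 * M))).mono
      (Continuous.aestronglyMeasurable (by fun_prop)) (ae_of_all _ fun p => ?_)
    rw [norm_mul, norm_mul]
    gcongr
    refine (norm_sub_le _ _).trans (le_trans ?_ (le_abs_self _))
    linarith [hM (p.1 + r • p.2), hM p.1]
  have hswap : ∫ a, η a * ∫ b in B, (q (a + r • b) - q a) ∂μ ∂μ = ∫ b in B, J b ∂μ := by
    simp_rw [← integral_const_mul]
    exact integral_integral_swap hprod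
  have hJint : IntegrableOn J B μ := hprod.integral_prod_right
  have hneg : ∫ b in B, J (-b) ∂μ = ∫ b in B, J b ∂μ := by
    have := (Measure.measurePreserving_neg μ).setIntegral_preimage_emb
      (MeasurableEquiv.neg X).measurableEmbedding J B
    rw [← this]
    congr 2
    ext b
    simp [B]
  have hJnegint : IntegrableOn (fun b => J (-b)) B μ := by
    have := ((Measure.measurePreserving_neg μ).integrableOn_comp_preimage
      (MeasurableEquiv.neg X).measurableEmbedding (f := J) (s := B)).2 hJint
    have hB : Neg.neg ⁻¹' B = B := by ext b; simp [B]
    rwa [hB] at this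
  have hmul : ∀ w : X, Integrable (fun a => η (a + w) * q a) μ := fun w =>
    (Continuous.integrable_of_hasCompactSupport (by fun_prop) hqc.mul_left)
  have hmul' : ∀ w : X, Integrable (fun a => η a * q (a + w)) μ := fun w =>
    (Continuous.integrable_of_hasCompactSupport (by fun_prop) hηc.mul_right)
  have hJ' : ∀ b, J b = ∫ a, (η (a + -(r • b)) - η a) * q a ∂μ := by
    intro b
    have h0 := hmul 0
    simp only [add_zero] at h0
    simp only [hJ, mul_sub, sub_mul]
    rw [integral_sub (hmul' _) h0, integral_sub (hmul _) h0]
    congr 1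
    rw [← integral_add_right_eq_self (fun a => η (a + -(r • b)) * q a) (r • b)]
    simp
  have hsym : ∀ b ∈ B, J b + J (-b) ≤ C * r ^ 2 * ∫ a, |q a| ∂μ := by
    intro b hb
    have hb1 : ‖b‖ ≤ 1 := by simpa [B] using hb
    have hi : ∀ w : X, Integrable (fun a => (η (a + w) - η a) * q a) μ := by
      intro w
      have h0 := hmul 0
      simp only [add_zero] at h0
      simp only [sub_mul]
      exact (hmul w).sub h0
    rw [hJ', hJ', ← integral_add (hi _) (hi _), ← integral_const_mul]
    refine integral_mono ((hi _).add (hi _)) ((hq.abs.integrable_of_hasCompactSupport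
      hqc.abs).const_mul _) fun a => ?_
    have h1 := hC a (r • b)
    have h2 : ‖r • b‖ ^ 2 ≤ r ^ 2 := by
      rw [norm_smul, mul_pow, Real.norm_eq_abs, sq_abs]
      nlinarith [sq_nonneg r, norm_nonneg b, mul_nonneg (sq_nonneg r) (norm_nonneg b)]
    have h3 : |η (a + r • b) + η (a - r • b) - 2 * η a| ≤ C * r ^ 2 :=
      h1.trans (mul_le_mul_of_nonneg_left h2 hC0)
    calc (η (a + -(r • b)) - η a) * q a + (η (a + -(r • -b)) - η a) * q a
        = (η (a + r • b) + η (a - r • b) - 2 * η a) * q a := by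
          rw [smul_neg, neg_neg, sub_eq_add_neg a]; ring
      _ ≤ |η (a + r • b) + η (a - r • b) - 2 * η a| * |q a| := by
          rw [← abs_mul]; exact le_abs_self _
      _ ≤ C * r ^ 2 * |q a| := by gcongr
  have h2 : 2 * ∫ b in B, J b ∂μ ≤ μ.real B * (C * r ^ 2 * ∫ a, |q a| ∂μ) := by
    calc 2 * ∫ b in B, J b ∂μ = ∫ b in B, (J b + J (-b)) ∂μ := by
          rw [integral_add hJint hJnegint, hneg]; ring
      _ ≤ ∫ _ in B, C * r ^ 2 * ∫ a, |q a| ∂μ ∂μ := by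
          refine setIntegral_mono_on (hJint.add hJnegint) (integrable_const _)
            Metric.isClosed_closedBall.measurableSet hsym
      _ = _ := by simp
  have h4 : 0 ≤ μ.real B * (C * r ^ 2 * ∫ a, |q a| ∂μ) := by positivity
  rw [hswap]
  linarith

/-- A Caccioppoli inequality: for a smooth function with values in `[0, 1]` satisfying the
super-mean value inequality on small balls near the support of the weight `η`, the weighted
Dirichlet energy is bounded by the integral of the function. -/
lemma exists_energy_le {η : X → ℝ} (hη : ContDiff ℝ (⊤ : ℕ∞) η) (hηc : HasCompactSupport η)
    (hη0 : ∀ a, 0 ≤ η a) :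
    ∃ C : ℝ, 0 ≤ C ∧ ∀ g : X → ℝ, ContDiff ℝ (⊤ : ℕ∞) g → HasCompactSupport g →
      (∀ a, g a ∈ Set.Icc (0 : ℝ) 1) →
      (∀ᶠ r in 𝓝[>] (0 : ℝ), ∀ a ∈ tsupport η, ∫ b in Metric.closedBall 0 1, g (a + r • b) ∂μ ≤
        μ.real (Metric.closedBall (0 : X) 1) * g a) →
      ∀ e : X, ‖e‖ ≤ 1 → ∫ a, η a * (fderiv ℝ g a e) ^ 2 ∂μ ≤ C * ∫ a, g a ∂μ := by
  set B : Set X := Metric.closedBall 0 1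
  have hBfin : μ B < ⊤ := measure_closedBall_lt_top
  have : IsFiniteMeasure (μ.restrict B) := ⟨by simpa using hBfin⟩
  have hBc : IsCompact B := isCompact_closedBall _ _
  obtain ⟨C, hC0, hC⟩ := exists_second_difference_le hη hηc
  obtain ⟨c, hc0, hc⟩ := exists_sq_apply_le_integral_closedBall μ
  refine ⟨c * (μ.real B * (C * 2)), by positivity, fun g hg hgc hg01 hmean e he => ?_⟩
  have hgcont : Continuous g := hg.continuous
  have hηcont : Continuous η := hη.continuous
  have hDcont : Continuous (fderiv ℝ g) := hg.continuous_fderiv (by simp)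
  have hgdiff : Differentiable ℝ g := hg.differentiable (by simp)
  have hgint : Integrable g μ := hgcont.integrable_of_hasCompactSupport hgc
  obtain ⟨L, hL⟩ : ∃ L, LipschitzWith L g :=
    ⟨_, (hg.lipschitzWith_of_hasCompactSupport hgc (by simp)).choose_spec⟩
  set Φ : ℝ → X × X → ℝ := fun r p => η p.1 * (r⁻¹ * (g (p.1 + r • p.2) - g p.1)) ^ 2
  set Ψ : X × X → ℝ := fun p => η p.1 * (fderiv ℝ g p.1 p.2) ^ 2
  have hbound : Integrable (fun p : X × X => η p.1 * (L * ‖p.2‖) ^ 2) (μ.prod (μ.restrict B)) :=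
    (hηcont.integrable_of_hasCompactSupport (μ := μ) hηc).mul_prod
      (f := η) (g := fun b => (L * ‖b‖) ^ 2)
      ((Continuous.continuousOn (by fun_prop)).integrableOn_compact hBc)
  have hΦle : ∀ r, r ≠ 0 → ∀ p, ‖Φ r p‖ ≤ η p.1 * (L * ‖p.2‖) ^ 2 := by
    intro r hr p
    have h1 : ‖r⁻¹ * (g (p.1 + r • p.2) - g p.1)‖ ≤ L * ‖p.2‖ := by
      have := hL.dist_le_mul (p.1 + r • p.2) p.1
      rw [dist_eq_norm, dist_eq_norm, add_sub_cancel_left, norm_smul] at this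
      rw [norm_mul, norm_inv, inv_mul_le_iff₀ (norm_pos_iff.2 hr)]
      linarith
    rw [norm_mul, norm_pow, Real.norm_of_nonneg (hη0 _)]
    gcongr
    exact hη0 _
  have hΦm : ∀ r, AEStronglyMeasurable (Φ r) (μ.prod (μ.restrict B)) := fun r =>
    Continuous.aestronglyMeasurable (by fun_prop)
  have hΦint : ∀ r, r ≠ 0 → Integrable (Φ r) (μ.prod (μ.restrict B)) := fun r hr =>
    hbound.mono' (hΦm r) (ae_of_all _ (hΦle r hr))
  have hpos : ∀ᶠ r in 𝓝[>] (0 : ℝ), r ≠ 0 := by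
    filter_upwards [self_mem_nhdsWithin] with r hr using ne_of_gt hr
  have hlim : Tendsto (fun r => ∫ p, Φ r p ∂(μ.prod (μ.restrict B))) (𝓝[>] 0)
      (𝓝 (∫ p, Ψ p ∂(μ.prod (μ.restrict B)))) := by
    refine tendsto_integral_filter_of_dominated_convergence _ (.of_forall hΦm)
      (hpos.mono fun r hr => ae_of_all _ (hΦle r hr)) hbound (ae_of_all _ fun p => ?_)
    have h1 := ((hgdiff p.1).hasFDerivAt.hasLineDerivAt p.2).tendsto_slope_zero
    exact ((h1.mono_left (nhdsWithin_mono _ fun r hr => ne_of_gt hr)).pow 2).const_mul _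
  set q : X → ℝ := fun a => g a ^ 2 - 2 * g a with hqdef
  have hqcont : Continuous q := by fun_prop
  have hqc : HasCompactSupport q := hgc.comp_left (g := fun t : ℝ => t ^ 2 - 2 * t) (by simp)
  have hqabs : ∫ a, |q a| ∂μ ≤ 2 * ∫ a, g a ∂μ := by
    rw [← integral_const_mul]
    refine integral_mono (hqcont.abs.integrable_of_hasCompactSupport hqc.abs)
      (hgint.const_mul _) fun a => abs_le.2 ?_
    obtain ⟨h0, h1⟩ := hg01 a
    constructor <;> simp only [hqdef] <;> nlinarith
  have hΦbound : ∀ᶠ r in 𝓝[>] (0 : ℝ), ∫ p, Φ r p ∂(μ.prod (μ.restrict B)) ≤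
      μ.real B * (C * 2) * ∫ a, g a ∂μ := by
    filter_upwards [hmean, self_mem_nhdsWithin] with r hr hr0
    have hr0' : (0 : ℝ) < r := hr0
    have hcomp : ∀ {k : X → ℝ}, Continuous k → IntegrableOn k B μ := fun hk =>
      hk.continuousOn.integrableOn_compact hBc
    have hpt : ∀ a, ∫ b in B, Φ r (a, b) ∂μ ≤
        (r ^ 2)⁻¹ * (η a * ∫ b in B, (q (a + r • b) - q a) ∂μ) := by
      intro a
      have e1 : ∫ b in B, Φ r (a, b) ∂μ =
          (r ^ 2)⁻¹ * (η a * ∫ b in B, (g (a + r • b) - g a) ^ 2 ∂μ) := by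
        rw [← integral_const_mul, ← integral_const_mul]
        refine integral_congr_ae (ae_of_all _ fun b => ?_)
        simp only [Φ]; ring
      rw [e1]
      by_cases ha : a ∈ tsupport η
      · refine mul_le_mul_of_nonneg_left (mul_le_mul_of_nonneg_left ?_ (hη0 a)) (by positivity)
        have e2 : (∫ b in B, (q (a + r • b) - q a) ∂μ) -
            ∫ b in B, (g (a + r • b) - g a) ^ 2 ∂μ =
            2 * (1 - g a) * (μ.real B * g a - ∫ b in B, g (a + r • b) ∂μ) := by
          have e3 : μ.real B * g a = ∫ _ in B, g a ∂μ := by simp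
          rw [e3, ← integral_sub (hcomp (by fun_prop)) (hcomp (by fun_prop)),
            ← integral_sub (hcomp (by fun_prop)) (hcomp (by fun_prop)), ← integral_const_mul]
          refine integral_congr_ae (ae_of_all _ fun b => ?_)
          simp only [hqdef]; ring
        have h1 := hr a ha
        have h2 := (hg01 a).2
        have : 0 ≤ 2 * (1 - g a) * (μ.real B * g a - ∫ b in B, g (a + r • b) ∂μ) :=
          mul_nonneg (by linarith) (by linarith)
        linarith
      · simp [image_eq_zero_of_notMem_tsupport ha]
    have htr := integral_translate_sub_le μ hηcont hηc hqcont hqc hC hC0 r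
    rw [integral_prod _ (hΦint r hr0'.ne')]
    calc ∫ a, ∫ b in B, Φ r (a, b) ∂μ ∂μ
        ≤ ∫ a, (r ^ 2)⁻¹ * (η a * ∫ b in B, (q (a + r • b) - q a) ∂μ) ∂μ := by
          refine integral_mono (hΦint r hr0'.ne').integral_prod_left ?_ hpt
          refine Integrable.const_mul (Continuous.integrable_of_hasCompactSupport
            (hηcont.mul ?_) hηc.mul_right) _
          exact continuous_parametric_integral_of_continuous (by fun_prop) hBc
      _ = (r ^ 2)⁻¹ * ∫ a, η a * ∫ b in B, (q (a + r • b) - q a) ∂μ ∂μ := integral_const_mul _ _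
      _ ≤ (r ^ 2)⁻¹ * (μ.real B * (C * r ^ 2 * ∫ a, |q a| ∂μ)) := by gcongr
      _ = μ.real B * C * ∫ a, |q a| ∂μ := by field_simp
      _ ≤ μ.real B * C * (2 * ∫ a, g a ∂μ) := by gcongr
      _ = _ := by ring
  have hΨ := le_of_tendsto hlim hΦbound
  have hΨint : Integrable Ψ (μ.prod (μ.restrict B)) := by
    refine hbound.mono' (Continuous.aestronglyMeasurable (by fun_prop)) (ae_of_all _ fun p => ?_)
    rw [norm_mul, norm_pow, Real.norm_of_nonneg (hη0 _)]
    have := (fderiv ℝ g p.1).le_opNorm p.2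
    have h2 := norm_fderiv_le_of_lipschitz ℝ hL (x₀ := p.1)
    gcongr
    · exact hη0 _
    · exact this.trans (by gcongr)
  rw [integral_prod _ hΨint] at hΨ
  calc ∫ a, η a * (fderiv ℝ g a e) ^ 2 ∂μ ≤ ∫ a, c * ∫ b in B, Ψ (a, b) ∂μ ∂μ := by
        refine integral_mono (Continuous.integrable_of_hasCompactSupport (by fun_prop)
          hηc.mul_right) (hΨint.integral_prod_left.const_mul _) fun a => ?_
        simp only [Ψ]
        rw [integral_const_mul, mul_left_comm]
        exact mul_le_mul_of_nonneg_left (hc _ e he) (hη0 a)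
    _ = c * ∫ a, ∫ b in B, Ψ (a, b) ∂μ ∂μ := integral_const_mul _ _
    _ ≤ c * (μ.real B * (C * 2) * ∫ a, g a ∂μ) := by gcongr
    _ = _ := by ring

end Caccioppoli

section Mollification

variable {X : Type*} [NormedAddCommGroup X] [NormedSpace ℝ X]
variable [MeasurableSpace X] [BorelSpace X] [FiniteDimensional ℝ X]
  (μ : Measure X) [μ.IsAddHaarMeasure]

/-- Mollifying a function with values in `[0, 1]` which satisfies the super-mean value inequality
on balls preserves that inequality, the integral, and the value `1` near compact sets. -/
lemma exists_mollification {G : X → ℝ} (hGm : Measurable G) (hG01 : ∀ a, G a ∈ Set.Icc (0 : ℝ) 1)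
    {x₀ : X} {ρ R : ℝ} (hρ : ρ < R) (hsupp : ∀ a ∉ Metric.closedBall x₀ R, G a = 0)
    (hmean : ∀ a r, 0 < r → Metric.closedBall a r ⊆ Metric.closedBall x₀ R →
      ∫ b in Metric.closedBall 0 1, G (a + r • b) ∂μ ≤
        μ.real (Metric.closedBall (0 : X) 1) * G a)
    {S O : Set X} (hS : IsCompact S) (hO : IsOpen O) (hSO : S ⊆ O) (hGO : ∀ a ∈ O, G a = 1) :
    ∃ g : X → ℝ, ContDiff ℝ (⊤ : ℕ∞) g ∧ HasCompactSupport g ∧ (∀ a, g a ∈ Set.Icc (0 : ℝ) 1) ∧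
      (∀ᶠ a in 𝓝ˢ S, g a = 1) ∧ ∫ a, g a ∂μ = ∫ a, G a ∂μ ∧
      ∀ᶠ r in 𝓝[>] (0 : ℝ), ∀ a ∈ Metric.closedBall x₀ ρ,
        ∫ b in Metric.closedBall 0 1, g (a + r • b) ∂μ ≤
          μ.real (Metric.closedBall (0 : X) 1) * g a := by
  set B : Set X := Metric.closedBall 0 1
  have hBfin : μ B < ⊤ := measure_closedBall_lt_top
  have : IsFiniteMeasure (μ.restrict B) := ⟨by simpa using hBfin⟩
  obtain ⟨δ, hδ, hδO⟩ := hS.exists_thickening_subset_open hO hSO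
  set ε : ℝ := min (δ / 2) ((R - ρ) / 2)
  have hε : 0 < ε := lt_min (by linarith) (by linarith)
  have hεδ : ε ≤ δ / 2 := min_le_left _ _
  have hεR : ε ≤ (R - ρ) / 2 := min_le_right _ _
  let φ : ContDiffBump (0 : X) := ⟨ε / 2, ε, by linarith, by linarith⟩
  set k : X → ℝ := φ.normed μ
  have hk0 : ∀ t, 0 ≤ k t := φ.nonneg_normed
  have hkint : Integrable k μ := φ.integrable_normed
  have hk1 : ∫ t, k t ∂μ = 1 := φ.integral_normed
  have hkcont : Continuous k := φ.continuous_normed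
  have hGcs : HasCompactSupport G := HasCompactSupport.intro (isCompact_closedBall x₀ R) hsupp
  have hGint : Integrable G μ := by
    have h1 : IntegrableOn G (Metric.closedBall x₀ R) μ :=
      (integrableOn_const (C := (1 : ℝ)) measure_closedBall_lt_top.ne).mono'
        hGm.aestronglyMeasurable (ae_of_all _ fun a => by
          rw [Real.norm_of_nonneg (hG01 a).1]; exact (hG01 a).2)
    exact h1.integrable_of_forall_notMem_eq_zero hsupp
  have hprodle : ∀ (t a : X), ‖k t * G a‖ ≤ k t := fun t a => by
    rw [Real.norm_of_nonneg (mul_nonneg (hk0 t) (hG01 a).1)]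
    exact mul_le_of_le_one_right (hk0 t) (hG01 a).2
  have hkG : ∀ a, Integrable (fun t => k t * G (a - t)) μ := fun a =>
    hkint.mono' (hkcont.measurable.mul (hGm.comp (measurable_const_sub a))).aestronglyMeasurable
      (ae_of_all _ fun t => hprodle _ _)
  set g : X → ℝ := convolution k G (ContinuousLinearMap.lsmul ℝ ℝ) μ
  have hg : ∀ a, g a = ∫ t, k t * G (a - t) ∂μ := fun a => rfl
  refine ⟨g, φ.hasCompactSupport_normed.contDiff_convolution_left _ φ.contDiff_normed
    hGint.locallyIntegrable, φ.hasCompactSupport_normed.convolution _ hGcs,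
    fun a => ⟨?_, ?_⟩, ?_, ?_, ?_⟩
  · rw [hg]
    exact integral_nonneg fun t => mul_nonneg (hk0 t) (hG01 _).1
  · rw [hg, ← hk1]
    exact integral_mono (hkG a) hkint fun t => mul_le_of_le_one_right (hk0 t) (hG01 _).2
  · filter_upwards [Metric.isOpen_thickening.mem_nhdsSet.2
      (Metric.self_subset_thickening (half_pos hδ) S)] with a ha
    have hball : ∀ y ∈ Metric.ball a ε, y ∈ O := by
      intro y hy
      obtain ⟨s, hs, has⟩ := Metric.mem_thickening_iff.1 ha
      refine hδO (Metric.mem_thickening_iff.2 ⟨s, hs, ?_⟩)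
      have := dist_triangle y a s
      rw [Metric.mem_ball] at hy
      linarith
    have h1 := hGO a (hball a (Metric.mem_ball_self hε))
    rw [← h1]
    exact φ.normed_convolution_eq_right fun y hy => by rw [hGO y (hball y hy), h1]
  · have := integral_convolution (ContinuousLinearMap.lsmul ℝ ℝ) (μ := μ) (ν := μ) hkint hGint
    simpa [hk1] using this
  · filter_upwards [Ioo_mem_nhdsGT (show (0 : ℝ) < (R - ρ) / 2 by linarith)] with r hr a ha
    have hInt : Integrable (fun p : X × X => k p.2 * G (a + r • p.1 - p.2))
        ((μ.restrict B).prod μ) := by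
      refine ((integrable_const (μ := μ.restrict B) (1 : ℝ)).mul_prod hkint).mono'
        ((hkcont.measurable.comp measurable_snd).mul
          (hGm.comp (Continuous.measurable (by fun_prop)))).aestronglyMeasurable
        (ae_of_all _ fun p => ?_)
      rw [one_mul]
      exact hprodle _ _
    calc ∫ b in B, g (a + r • b) ∂μ = ∫ t, ∫ b in B, k t * G (a + r • b - t) ∂μ ∂μ :=
          integral_integral_swap hInt
      _ ≤ ∫ t, μ.real B * (k t * G (a - t)) ∂μ := by
          refine integral_mono hInt.integral_prod_right ((hkG a).const_mul _) fun t => ?_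
          simp only
          rw [integral_const_mul, mul_left_comm]
          by_cases ht : k t = 0
          · simp [ht]
          have ht' : t ∈ Function.support k := ht
          rw [φ.support_normed_eq, mem_ball_zero_iff] at ht'
          have hsub : Metric.closedBall (a - t) r ⊆ Metric.closedBall x₀ R := by
            refine Metric.closedBall_subset_closedBall' ?_
            have h1 : dist (a - t) x₀ ≤ ‖t‖ + dist a x₀ := by
              refine (dist_triangle _ a _).trans ?_
              simp [dist_eq_norm]
            have h2 : dist a x₀ ≤ ρ := ha
            have h3 : ‖t‖ < ε := ht'
            linarith [hr.2]
          have := hmean (a - t) r hr.1 hsub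
          refine mul_le_mul_of_nonneg_left ?_ (hk0 t)
          simpa only [sub_add_eq_add_sub] using this
      _ = μ.real B * g a := by rw [integral_const_mul, hg]

end Mollification

section Plurisubharmonic

open scoped Pointwise

variable {n : ℕ}

lemma measurePreserving_unit_smul {c : ℂ} (hc : ‖c‖ = 1) :
    MeasurePreserving (fun b : Fin n → ℂ => c • b) := by
  have h : MeasurePreserving (fun z : ℂ => c * z) :=
    (rotation ⟨c, mem_sphere_zero_iff_norm.2 hc⟩).measurePreserving
  exact volume_preserving_pi (f := fun _ : Fin n => fun z : ℂ => c * z) fun _ => h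

/-- Averaging the super-mean value inequality over complex discs yields it over balls. -/
lemma lintegral_closedBall_le_of_circle {F : (Fin n → ℂ) → ℝ≥0∞} (hF : Measurable F)
    {a : Fin n → ℂ} {r : ℝ}
    (h : ∀ b ∈ Metric.closedBall (0 : Fin n → ℂ) 1,
      (∫⁻ θ in Set.Ioc (0 : ℝ) (2 * Real.pi),
        F (a + ((r : ℂ) * Complex.exp (θ * Complex.I)) • b)) / ENNReal.ofReal (2 * Real.pi) ≤
        F a) :
    ∫⁻ b in Metric.closedBall 0 1, F (a + r • b) ≤
      volume (Metric.closedBall (0 : Fin n → ℂ) 1) * F a := by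
  set B : Set (Fin n → ℂ) := Metric.closedBall 0 1
  have hpi : ENNReal.ofReal (2 * Real.pi) ≠ 0 := by simp [Real.pi_pos]
  have hrot : ∀ θ : ℝ, ∫⁻ b in B, F (a + ((r : ℂ) * Complex.exp (θ * Complex.I)) • b) =
      ∫⁻ b in B, F (a + r • b) := by
    intro θ
    have hc : ‖Complex.exp (θ * Complex.I)‖ = 1 := Complex.norm_exp_ofReal_mul_I θ
    have hmeas : Measurable fun b : Fin n → ℂ => F (a + r • b) :=
      hF.comp (Continuous.measurable (by fun_prop))
    have := (measurePreserving_unit_smul (n := n) hc).setLIntegral_comp_preimage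
      (Metric.isClosed_closedBall.measurableSet : MeasurableSet B) hmeas
    rw [← this]
    have hB : (fun b : Fin n → ℂ => Complex.exp (θ * Complex.I) • b) ⁻¹' B = B := by
      ext b
      simp [B, norm_smul, hc]
    rw [hB]
    refine lintegral_congr fun b => ?_
    rw [mul_smul]
    rfl
  have hmeas2 : Measurable fun p : ℝ × (Fin n → ℂ) =>
      F (a + ((r : ℂ) * Complex.exp (p.1 * Complex.I)) • p.2) :=
    hF.comp (Continuous.measurable (by fun_prop))
  have h1 : ENNReal.ofReal (2 * Real.pi) * ∫⁻ b in B, F (a + r • b) ≤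
      ENNReal.ofReal (2 * Real.pi) * (volume B * F a) := by
    calc ENNReal.ofReal (2 * Real.pi) * ∫⁻ b in B, F (a + r • b)
        = ∫⁻ θ in Set.Ioc (0 : ℝ) (2 * Real.pi), ∫⁻ b in B,
            F (a + ((r : ℂ) * Complex.exp (θ * Complex.I)) • b) := by
          simp_rw [hrot]
          simp [mul_comm]
      _ = ∫⁻ b in B, ∫⁻ θ in Set.Ioc (0 : ℝ) (2 * Real.pi),
            F (a + ((r : ℂ) * Complex.exp (θ * Complex.I)) • b) :=
          lintegral_lintegral_swap hmeas2.aemeasurable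
      _ ≤ ∫⁻ _ in B, F a * ENNReal.ofReal (2 * Real.pi) := by
          refine setLIntegral_mono' Metric.isClosed_closedBall.measurableSet fun b hb => ?_
          exact (ENNReal.div_le_iff hpi ENNReal.ofReal_ne_top).1 (h b hb)
      _ = _ := by rw [setLIntegral_const]; ring
  exact (ENNReal.mul_le_mul_iff_right hpi ENNReal.ofReal_ne_top).1 h1

lemma le_toENNReal_sub {x : EReal} {I : ℝ≥0∞} {M : ℝ} (h : x + (I : EReal) ≤ (M : EReal)) :
    I ≤ ((M : EReal) - x).toENNReal := by
  induction x with
  | bot => simp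
  | top =>
    rw [EReal.top_add_of_ne_bot (by simp)] at h
    exact absurd h (by simp)
  | coe w =>
    have h2 : (I : EReal) ≤ (M : EReal) - w := by
      rw [EReal.le_sub_iff_add_le (by simp) (by simp), add_comm]
      exact h
    simpa using EReal.toENNReal_le_toENNReal h2

/-- Near a point, `M - v` for `v` plurisubharmonic is a nonnegative function with the super-mean
value property on balls, infinite exactly on the polar set of `v`. -/
lemma PlurisubharmonicOn.exists_potential {v : (Fin n → ℂ) → EReal} {U : Set (Fin n → ℂ)}
    (hv : PlurisubharmonicOn v U) {x₀ : Fin n → ℂ} {R : ℝ} (hR : 0 < R)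
    (hU : Metric.closedBall x₀ R ⊆ U) :
    ∃ F : (Fin n → ℂ) → ℝ≥0∞, Measurable F ∧
      (∀ a r, 0 < r → Metric.closedBall a r ⊆ Metric.closedBall x₀ R →
        ∫⁻ b in Metric.closedBall 0 1, F (a + r • b) ≤
          volume (Metric.closedBall (0 : Fin n → ℂ) 1) * F a) ∧
      (∀ a ∈ Metric.closedBall x₀ R, F a = ⊤ ↔ v a = ⊥) ∧
      (∀ a ∉ Metric.closedBall x₀ R, F a = 0) ∧
      ∀ k : ℕ, ∃ O, IsOpen O ∧ Metric.ball x₀ R ∩ {z | v z = ⊥} ⊆ O ∧ ∀ a ∈ O, (k : ℝ≥0∞) ≤ F a := by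
  classical
  obtain ⟨husc, htop, hmv⟩ := hv
  set K := Metric.closedBall x₀ R
  have hKne : K.Nonempty := Metric.nonempty_closedBall.2 hR.le
  obtain ⟨M, hM⟩ : ∃ M : ℝ, ∀ z ∈ K, v z ≤ (M : EReal) := by
    obtain ⟨y, hy, hmax⟩ := (husc.mono hU).exists_isMaxOn hKne (isCompact_closedBall _ _)
    refine ⟨(v y).toReal, fun z hz => (hmax hz).trans ?_⟩
    exact EReal.le_coe_toReal (htop y (hU hy)).ne
  set F : (Fin n → ℂ) → ℝ≥0∞ := fun z => if z ∈ K then ((M : EReal) - v z).toENNReal else 0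
  have hFK : ∀ z ∈ K, F z = ((M : EReal) - v z).toENNReal := fun z hz => if_pos hz
  have hKm : MeasurableSet K := Metric.isClosed_closedBall.measurableSet
  have hFm : Measurable F := by
    refine measurable_of_restrict_of_restrict_compl hKm ?_ ?_
    · have h1 : Measurable (K.domRestrict v) :=
        (upperSemicontinuousOn_iff_restrict.2 (husc.mono hU)).measurable
      have h2 : K.domRestrict F = fun z => ((M : EReal) - K.domRestrict v z).toENNReal :=
        funext fun z => hFK z z.2
      rw [h2]
      exact measurable_ereal_toENNReal.comp (measurable_const.sub h1)
    · have h2 : Kᶜ.domRestrict F = fun _ => 0 := funext fun z => if_neg z.2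
      rw [h2]
      exact measurable_const
  refine ⟨F, hFm, fun a r hr hsub => lintegral_closedBall_le_of_circle hFm fun b hb => ?_,
    fun a ha => ?_, fun a ha => if_neg ha, fun k => ?_⟩
  · have hb1 : ‖b‖ ≤ 1 := by simpa using hb
    have hdisc : ∀ τ : ℂ, ‖τ‖ ≤ r → a + τ • b ∈ K := fun τ hτ => hsub (by
      rw [Metric.mem_closedBall, dist_eq_norm, add_sub_cancel_left, norm_smul]
      nlinarith [norm_nonneg τ, norm_nonneg b])
    have hcirc : ∀ θ : ℝ, a + ((r : ℂ) * Complex.exp (θ * Complex.I)) • b ∈ K := fun θ =>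
      hdisc _ (by rw [norm_mul, Complex.norm_exp_ofReal_mul_I]; simp [abs_of_pos hr])
    have haK : a ∈ K := hsub (Metric.mem_closedBall_self hr.le)
    have := le_toENNReal_sub
      (hmv a (hU haK) b r hr (fun τ hτ => hU (hdisc τ hτ)) M fun θ => hM _ (hcirc θ))
    rw [hFK a haK]
    refine le_trans (le_of_eq ?_) this
    congr 1
    refine lintegral_congr fun θ => ?_
    rw [hFK _ (hcirc θ)]
    rfl
  · rw [hFK a ha, EReal.toENNReal_eq_top_iff]
    have := htop a (hU ha)
    induction hx : v a with
    | bot => simp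
    | top => simp [hx] at this
    | coe w => simpa using (EReal.coe_ne_top (M - w))
  · obtain ⟨O, hO, hOeq⟩ := upperSemicontinuousOn_iff_preimage_Iio.1
      ((husc.mono hU).mono Metric.ball_subset_closedBall) (((M - k : ℝ)) : EReal)
    refine ⟨Metric.ball x₀ R ∩ O, Metric.isOpen_ball.inter hO, ?_, ?_⟩
    · rw [← hOeq]
      rintro z ⟨hz, hz2⟩
      refine ⟨hz, ?_⟩
      rw [Set.mem_preimage, show v z = ⊥ from hz2]
      exact EReal.bot_lt_coe _
    · rw [← hOeq]
      rintro z ⟨hz, hz2⟩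
      rw [hFK z (Metric.ball_subset_closedBall hz)]
      have h1 : ((k : ℝ) : EReal) ≤ (M : EReal) - v z := by
        refine le_trans (le_of_eq ?_) (EReal.sub_le_sub le_rfl (le_of_lt hz2))
        rw [← EReal.coe_sub]
        congr 1
        ring
      have h2 := EReal.toENNReal_le_toENNReal h1
      rwa [EReal.real_coe_toENNReal, ENNReal.ofReal_natCast] at h2

/-- The polar set of a plurisubharmonic function which is not identically `-∞` is null. -/
lemma PlurisubharmonicOn.volume_eq_bot_eq_zero {v : (Fin n → ℂ) → EReal} {U : Set (Fin n → ℂ)}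
    (hv : PlurisubharmonicOn v U) (hUo : IsOpen U) (hUc : IsConnected U)
    (hne : ∃ z ∈ U, v z ≠ ⊥) : volume (U ∩ {z | v z = ⊥}) = 0 := by
  set Z := U ∩ {z | v z = ⊥}
  have hprop : ∀ x ∈ U, ∃ r > 0, Metric.ball x r ⊆ U ∧
      (volume (Z ∩ Metric.ball x r) ≠ 0 → Metric.ball x r ⊆ Z) := by
    intro x hx
    obtain ⟨R, hR, hRU⟩ := Metric.nhds_basis_closedBall.mem_iff.1 (hUo.mem_nhds hx)
    obtain ⟨F, hFm, hF, htop, -, -⟩ := hv.exists_potential hR hRU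
    refine ⟨R / 3, by linarith,
      (Metric.ball_subset_closedBall.trans (Metric.closedBall_subset_closedBall (by linarith))).trans
        hRU, fun hpos a ha => ?_⟩
    have hr : (0 : ℝ) < 2 * R / 3 := by linarith
    have ha' : dist a x < R / 3 := ha
    have hsub : Metric.closedBall a (2 * R / 3) ⊆ Metric.closedBall x R :=
      Metric.closedBall_subset_closedBall' (by linarith)
    have haK : a ∈ Metric.closedBall x R := hsub (Metric.mem_closedBall_self hr.le)
    refine ⟨hRU haK, (htop a haK).1 ?_⟩
    by_contra hFa
    have hfin : ∫⁻ b in Metric.closedBall 0 1, F (a + (2 * R / 3) • b) ≠ ⊤ :=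
      ((hF a _ hr hsub).trans_lt
        (ENNReal.mul_lt_top measure_closedBall_lt_top (lt_top_iff_ne_top.2 hFa))).ne
    have hae := ae_lt_top (hFm.comp (Continuous.measurable (by fun_prop))) hfin
    rw [ae_restrict_iff' Metric.isClosed_closedBall.measurableSet, ae_iff] at hae
    refine hpos ?_
    have hpre : Z ∩ Metric.ball x (R / 3) ⊆
        (fun z => a + (2 * R / 3) • z) '' {b | ¬ (b ∈ Metric.closedBall (0 : Fin n → ℂ) 1 →
          (F ∘ fun b => a + (2 * R / 3) • b) b < ⊤)} := by
      rintro z ⟨⟨hzU, hz⟩, hzb⟩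
      have hzx : dist z x < R / 3 := hzb
      refine ⟨(2 * R / 3)⁻¹ • (z - a), ?_, ?_⟩
      · have hza : ‖z - a‖ ≤ 2 * R / 3 := by
          rw [← dist_eq_norm]
          linarith [dist_triangle_right z a x]
        simp only [Set.mem_ofPred_eq, Function.comp, smul_inv_smul₀ hr.ne', add_sub_cancel,
          Classical.not_imp, mem_closedBall_zero_iff, norm_smul, norm_inv,
          Real.norm_of_nonneg hr.le]
        refine ⟨?_, ?_⟩
        · rw [inv_mul_le_iff₀ hr]; linarith
        · rw [(htop z (Metric.mem_closedBall.2 (by linarith))).2 hz]; simp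
      · simp only [smul_inv_smul₀ hr.ne', add_sub_cancel]
    refine measure_mono_null hpre ?_
    have himg : ∀ s : Set (Fin n → ℂ), volume s = 0 →
        volume ((fun z => a + (2 * R / 3) • z) '' s) = 0 := by
      intro s hs
      have : (fun z => a + (2 * R / 3) • z) '' s = (fun z => a + z) '' ((2 * R / 3) • s) := by
        rw [← Set.image_smul, Set.image_image]
      rw [this, Set.image_add_left, measure_preimage_add, Measure.addHaar_smul, hs, mul_zero]
    exact himg _ hae
  by_contra hZ
  obtain ⟨x, hxZ, hx⟩ : ∃ x ∈ Z, ∀ t ∈ 𝓝[Z] x, volume t ≠ 0 := by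
    by_contra! hcon
    exact hZ (measure_null_of_locally_null Z hcon)
  set W : Set (Fin n → ℂ) := {y | y ∈ U ∧ ∀ t ∈ 𝓝 y, volume (Z ∩ t) ≠ 0}
  have hxW : x ∈ W := ⟨hxZ.1, fun t ht => hx _ (inter_mem_nhdsWithin _ ht)⟩
  have hWball : ∀ y ∈ W, ∃ r > 0, Metric.ball y r ⊆ Z := fun y hy => by
    obtain ⟨r, hr, -, h⟩ := hprop y hy.1
    exact ⟨r, hr, h (hy.2 _ (Metric.ball_mem_nhds y hr))⟩
  have hWZ : W ⊆ Z := fun y hy => by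
    obtain ⟨r, hr, h⟩ := hWball y hy
    exact h (Metric.mem_ball_self hr)
  have hUW : U ⊆ W := by
    refine hUc.isPreconnected.subset_of_closure_inter_subset ?_ ⟨x, hxZ.1, hxW⟩ ?_
    · rw [Metric.isOpen_iff]
      intro y hy
      obtain ⟨r, hr, h⟩ := hWball y hy
      refine ⟨r, hr, fun z hz => ⟨(h hz).1, fun t ht => ?_⟩⟩
      have hopen : Metric.ball y r ∩ t ∈ 𝓝 z :=
        inter_mem (Metric.isOpen_ball.mem_nhds hz) ht
      exact ne_of_gt ((Measure.measure_pos_of_mem_nhds volume hopen).trans_le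
        (measure_mono fun w hw => ⟨h hw.1, hw.2⟩))
    · rintro y ⟨hyc, hyU⟩
      refine ⟨hyU, fun t ht => ?_⟩
      obtain ⟨w, hwt, hwW⟩ := mem_closure_iff_nhds.1 hyc _ (interior_mem_nhds.2 ht)
      have := hwW.2 _ (isOpen_interior.mem_nhds hwt)
      exact fun h0 => this (measure_mono_null (Set.inter_subset_inter_right _ interior_subset) h0)
  obtain ⟨z, hzU, hz⟩ := hne
  exact hz (hWZ (hUW hzU)).2

end Plurisubharmonic

section Cutoff

variable {n : ℕ}

/-- Truncating a nonnegative function with the super-mean value property and rescaling it to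
`[0, 1]` preserves that property. -/
lemma integral_truncation_le {F : (Fin n → ℂ) → ℝ≥0∞} (hF : Measurable F) {a : Fin n → ℂ} {r : ℝ}
    (h : ∫⁻ b in Metric.closedBall 0 1, F (a + r • b) ≤
      volume (Metric.closedBall (0 : Fin n → ℂ) 1) * F a) (k : ℕ) :
    ∫ b in Metric.closedBall 0 1, (min (F (a + r • b)) k).toReal / k ≤
      volume.real (Metric.closedBall (0 : Fin n → ℂ) 1) * ((min (F a) k).toReal / k) := by
  set B : Set (Fin n → ℂ) := Metric.closedBall 0 1
  have hB : volume B ≠ ⊤ := measure_closedBall_lt_top.ne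
  have hfin : ∀ z, min (F z) k < ⊤ := fun z => (min_le_right _ _).trans_lt (by simp)
  have h1 : ∫⁻ b in B, min (F (a + r • b)) k ≤ volume B * min (F a) k := by
    rcases le_total (F a) k with hk | hk
    · rw [min_eq_left hk]
      exact (lintegral_mono fun b => min_le_left _ _).trans h
    · rw [min_eq_right hk]
      refine (lintegral_mono fun b => min_le_right _ _).trans (le_of_eq ?_)
      rw [setLIntegral_const, mul_comm]
  have hm : Measurable fun b => F (a + r • b) := hF.comp (Continuous.measurable (by fun_prop))
  rw [integral_div, ← mul_div_assoc, integral_toReal (hm.min measurable_const).aemeasurable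
    (ae_of_all _ fun b => hfin _), Measure.real, ← ENNReal.toReal_mul]
  gcongr
  exact ENNReal.mul_ne_top hB (hfin a).ne

/-- A pluripolar set has zero capacity: near every point there are smooth functions equal to `1`
near a given compact part of the set with arbitrarily small norm and Dirichlet energy. -/
lemma PluripolarIn.exists_cutoff {E Ω : Set (Fin n → ℂ)} (hE : PluripolarIn E Ω)
    {x : Fin n → ℂ} (hx : x ∈ Ω) :
    ∃ ρ > 0, Metric.ball x ρ ⊆ Ω ∧ volume (E ∩ Metric.ball x ρ) = 0 ∧
      ∀ S, IsCompact S → S ⊆ E ∩ Metric.ball x ρ → ∀ ε > 0, ∃ g : (Fin n → ℂ) → ℝ,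
        ContDiff ℝ (⊤ : ℕ∞) g ∧ (∀ a, g a ∈ Set.Icc (0 : ℝ) 1) ∧ (∀ᶠ a in 𝓝ˢ S, g a = 1) ∧
        ∫ a in Metric.ball x ρ, g a ≤ ε ∧
        ∀ e, ‖e‖ ≤ 1 → ∫ a in Metric.ball x ρ, (fderiv ℝ g a e) ^ 2 ≤ ε := by
  obtain ⟨U, hUo, hUc, hxU, hUΩ, v, hv, hne, hvE⟩ := hE x hx
  have hnull := hv.volume_eq_bot_eq_zero hUo hUc hne
  obtain ⟨R, hR, hRU⟩ := Metric.nhds_basis_closedBall.mem_iff.1 (hUo.mem_nhds hxU)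
  obtain ⟨F, hFm, hF, htop, hFzero, hopen⟩ := hv.exists_potential hR hRU
  have hballU : Metric.ball x (R / 4) ⊆ U :=
    (Metric.ball_subset_closedBall.trans (Metric.closedBall_subset_closedBall (by linarith))).trans
      hRU
  let η : ContDiffBump x := ⟨R / 4, R / 2, by linarith, by linarith⟩
  obtain ⟨C, hC0, hC⟩ := exists_energy_le volume (η := η) η.contDiff η.hasCompactSupport
    fun a => η.nonneg
  have hEnull : E ∩ Metric.ball x (R / 4) ⊆ U ∩ {z | v z = ⊥} := fun z hz =>
    ⟨hballU hz.2, hvE z ⟨hz.1, hballU hz.2⟩⟩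
  refine ⟨R / 4, by linarith, hballU.trans hUΩ, measure_mono_null hEnull hnull,
    fun S hS hSE ε hε => ?_⟩
  set G : ℕ → (Fin n → ℂ) → ℝ := fun k a => (min (F a) k).toReal / k
  have hGm : ∀ k, Measurable (G k) := fun k =>
    (hFm.min measurable_const).ennreal_toReal.div_const _
  have hG01 : ∀ k a, G k a ∈ Set.Icc (0 : ℝ) 1 := fun k a => by
    refine ⟨by positivity, div_le_one_of_le₀ ?_ (by positivity)⟩
    exact (ENNReal.toReal_mono (by simp) (min_le_right _ _)).trans (by simp)
  have hGzero : ∀ k, ∀ a ∉ Metric.closedBall x R, G k a = 0 := fun k a ha => by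
    simp [G, hFzero a ha]
  have hGlim : Tendsto (fun k => ∫ a, G k a) atTop (𝓝 0) := by
    have hae : ∀ᵐ a, F a ≠ ⊤ := by
      refine measure_mono_null (fun a ha => ?_) hnull
      have ha' : F a = ⊤ := not_not.1 ha
      have haK : a ∈ Metric.closedBall x R := by
        by_contra h
        simp [hFzero a h] at ha'
      exact ⟨hRU haK, (htop a haK).1 ha'⟩
    rw [← integral_zero (Fin n → ℂ) ℝ (μ := volume)]
    refine tendsto_integral_of_dominated_convergence
      ((Metric.closedBall x R).indicator fun _ => (1 : ℝ))
      (fun k => (hGm k).aestronglyMeasurable)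
      ((integrable_indicator_iff Metric.isClosed_closedBall.measurableSet).2
        (integrableOn_const measure_closedBall_lt_top.ne)) (fun k => ae_of_all _ fun a => ?_) ?_
    · by_cases ha : a ∈ Metric.closedBall x R
      · rw [Set.indicator_of_mem ha, Real.norm_of_nonneg (hG01 k a).1]
        exact (hG01 k a).2
      · rw [Set.indicator_of_notMem ha, hGzero k a ha, norm_zero]
    · filter_upwards [hae] with a ha
      refine squeeze_zero (fun k => (hG01 k a).1) (fun k => ?_)
        (tendsto_const_div_atTop_nhds_zero_nat (F a).toReal)
      simp only [G]
      gcongr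
      exact min_le_left _ _
  obtain ⟨k, hk1, hk⟩ : ∃ k : ℕ, 1 ≤ k ∧ ∫ a, G k a < min ε (ε / (C + 1)) :=
    ((eventually_ge_atTop 1).and (hGlim.eventually_lt_const (lt_min hε (by positivity)))).exists
  have hk0 : (k : ℝ) ≠ 0 := by positivity
  obtain ⟨O, hO, hSO, hFO⟩ := hopen k
  have hSsub : S ⊆ O := fun z hz => hSO
    ⟨Metric.ball_subset_ball (by linarith) (hSE hz).2, hvE z ⟨(hSE hz).1, hballU (hSE hz).2⟩⟩
  obtain ⟨g, hg, hgc, hg01, hgS, hgint, hgmean⟩ := exists_mollification volume (hGm k) (hG01 k)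
    (show R / 2 < R by linarith) (hGzero k)
    (fun a r hr hsub => integral_truncation_le hFm (hF a r hr hsub) k) hS hO hSsub
    (fun a ha => by simp [G, min_eq_right (hFO a ha), hk0])
  have hgI : Integrable g := hg.continuous.integrable_of_hasCompactSupport hgc
  have hDcont : Continuous (fderiv ℝ g) := hg.continuous_fderiv (by simp)
  refine ⟨g, hg, hg01, hgS, ?_, fun e he => ?_⟩
  · calc ∫ a in Metric.ball x (R / 4), g a ≤ ∫ a, g a :=
          setIntegral_le_integral hgI (ae_of_all _ fun a => (hg01 a).1)
      _ ≤ ε := by rw [hgint]; exact (hk.trans_le (min_le_left _ _)).le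
  · have hInt : Integrable fun a => η a * (fderiv ℝ g a e) ^ 2 :=
      Continuous.integrable_of_hasCompactSupport
        (η.continuous.mul ((hDcont.clm_apply continuous_const).pow 2)) η.hasCompactSupport.mul_right
    calc ∫ a in Metric.ball x (R / 4), (fderiv ℝ g a e) ^ 2
        = ∫ a in Metric.ball x (R / 4), η a * (fderiv ℝ g a e) ^ 2 := by
          refine setIntegral_congr_fun Metric.isOpen_ball.measurableSet fun a ha => ?_
          rw [η.one_of_mem_closedBall (Metric.ball_subset_closedBall ha), one_mul]
      _ ≤ ∫ a, η a * (fderiv ℝ g a e) ^ 2 :=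
          setIntegral_le_integral hInt (ae_of_all _ fun a => mul_nonneg η.nonneg (sq_nonneg _))
      _ ≤ C * ∫ a, g a := by
          refine hC g hg hgc hg01 ?_ e he
          rw [η.tsupport_eq]
          exact hgmean
      _ ≤ C * (ε / (C + 1)) := by
          rw [hgint]
          gcongr
          exact (hk.trans_le (min_le_right _ _)).le
      _ ≤ ε := by
          rw [mul_div_assoc', div_le_iff₀ (by positivity)]
          nlinarith

end Cutoff

section Removability

variable {n : ℕ}

lemma dbarCoord_mul {p q : (Fin n → ℂ) → ℂ} {z : Fin n → ℂ} (hp : DifferentiableAt ℝ p z)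
    (hq : DifferentiableAt ℝ q z) (j : Fin n) :
    dbarCoord (fun y => p y * q y) j z = p z * dbarCoord q j z + dbarCoord p j z * q z := by
  simp only [dbarCoord, fderiv_fun_mul hp hq, _root_.add_apply,
    _root_.smul_apply, smul_eq_mul]
  ring

lemma dbarCoord_add {p q : (Fin n → ℂ) → ℂ} {z : Fin n → ℂ} (hp : DifferentiableAt ℝ p z)
    (hq : DifferentiableAt ℝ q z) (j : Fin n) :
    dbarCoord (fun y => p y + q y) j z = dbarCoord p j z + dbarCoord q j z := by
  simp only [dbarCoord, fderiv_fun_add hp hq, _root_.add_apply]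
  ring

lemma continuous_dbarCoord {p : (Fin n → ℂ) → ℂ} (hp : ContDiff ℝ (⊤ : ℕ∞) p) (j : Fin n) :
    Continuous (dbarCoord p j) := by
  have := hp.continuous_fderiv (by simp)
  unfold dbarCoord
  fun_prop

lemma dbarCoord_eq_zero_of_notMem_tsupport {p : (Fin n → ℂ) → ℂ} {z : Fin n → ℂ}
    (hz : z ∉ tsupport p) (j : Fin n) : dbarCoord p j z = 0 := by
  have : fderiv ℝ p z = 0 := by
    by_contra h
    exact hz (support_fderiv_subset ℝ h)
  simp [dbarCoord, this]

lemma norm_sq_dbarCoord_ofReal {g : (Fin n → ℂ) → ℝ} {z : Fin n → ℂ}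
    (hg : DifferentiableAt ℝ g z) (j : Fin n) :
    ‖dbarCoord (fun y => (g y : ℂ)) j z‖ ^ 2 =
      1 / 4 * ((fderiv ℝ g z (Pi.single j 1)) ^ 2 + (fderiv ℝ g z (Pi.single j Complex.I)) ^ 2) := by
  have h : fderiv ℝ (fun y => (g y : ℂ)) z = Complex.ofRealCLM.comp (fderiv ℝ g z) :=
    (Complex.ofRealCLM.hasFDerivAt.comp z hg.hasFDerivAt).fderiv
  rw [dbarCoord, h, Complex.sq_norm, Complex.normSq_apply]
  simp
  ring

namespace IsTestFunOn

lemma mul_left {D : Set (Fin n → ℂ)} {χ p : (Fin n → ℂ) → ℂ} (hχ : IsTestFunOn D χ)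
    (hp : ContDiff ℝ (⊤ : ℕ∞) p) : IsTestFunOn D fun z => p z * χ z :=
  ⟨hp.mul hχ.1, hχ.2.1.mul_left, (tsupport_mul_subset_right).trans hχ.2.2⟩

lemma mono {D D' : Set (Fin n → ℂ)} {χ : (Fin n → ℂ) → ℂ} (hχ : IsTestFunOn D χ)
    (h : D ⊆ D') : IsTestFunOn D' χ :=
  ⟨hχ.1, hχ.2.1, hχ.2.2.trans h⟩

lemma differentiable {D : Set (Fin n → ℂ)} {χ : (Fin n → ℂ) → ℂ} (hχ : IsTestFunOn D χ) :
    Differentiable ℝ χ :=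
  hχ.1.differentiable (by simp)

end IsTestFunOn

/-- The integrand of a distributional first-order `∂̄`-equation tested against `χ`. -/
def dbarPairing (a b c : (Fin n → ℂ) → ℂ) (i j : Fin n) (χ : (Fin n → ℂ) → ℂ)
    (z : Fin n → ℂ) : ℂ :=
  a z * dbarCoord χ i z + b z * dbarCoord χ j z + c z * χ z

lemma dbarPairing_add {a b c χ χ' : (Fin n → ℂ) → ℂ} (i j : Fin n) (hχ : Differentiable ℝ χ)
    (hχ' : Differentiable ℝ χ') (z : Fin n → ℂ) :
    dbarPairing a b c i j (fun y => χ y + χ' y) z =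
      dbarPairing a b c i j χ z + dbarPairing a b c i j χ' z := by
  simp only [dbarPairing, dbarCoord_add (hχ z) (hχ' z)]
  ring

lemma dbarPairing_mul {a b c p χ : (Fin n → ℂ) → ℂ} (i j : Fin n) (hp : Differentiable ℝ p)
    (hχ : Differentiable ℝ χ) (z : Fin n → ℂ) :
    dbarPairing a b c i j (fun y => p y * χ y) z = p z * dbarPairing a b c i j χ z +
      dbarCoord p i z * (a z * χ z) + dbarCoord p j z * (b z * χ z) := by
  simp only [dbarPairing, dbarCoord_mul (hp z) (hχ z)]
  ring

/-- Local square integrability on `D`. -/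
def LocallyL2On (D : Set (Fin n → ℂ)) (a : (Fin n → ℂ) → ℂ) : Prop :=
  ∀ K, IsCompact K → K ⊆ D → MemLp a 2 (volume.restrict K)

lemma LocallyL2On.memLp_mul {D K : Set (Fin n → ℂ)} {a κ : (Fin n → ℂ) → ℂ}
    (ha : LocallyL2On D a) (hK : IsCompact K) (hKD : K ⊆ D) (hκ : Continuous κ)
    (hκ0 : ∀ z ∉ K, κ z = 0) : MemLp (fun z => a z * κ z) 2 := by
  obtain ⟨M, hM⟩ := (HasCompactSupport.intro hK hκ0).exists_bound_of_continuous hκ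
  have h : (fun z => a z * κ z) = K.indicator fun z => a z * κ z := by
    refine (Set.indicator_eq_self.2 fun z hz => ?_).symm
    by_contra hzK
    simp [hκ0 z hzK] at hz
  rw [h, memLp_indicator_iff_restrict hK.isClosed.measurableSet]
  refine (ha K hK hKD).of_le_mul (c := M)
    ((ha K hK hKD).aestronglyMeasurable.mul hκ.aestronglyMeasurable) (ae_of_all _ fun z => ?_)
  rw [norm_mul, mul_comm]
  exact mul_le_mul_of_nonneg_right (hM z) (norm_nonneg _)

lemma LocallyL2On.memLp_dbarPairing {D : Set (Fin n → ℂ)} {a b c χ : (Fin n → ℂ) → ℂ}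
    (ha : LocallyL2On D a) (hb : LocallyL2On D b) (hc : LocallyL2On D c) (i j : Fin n)
    (hχ : IsTestFunOn D χ) : MemLp (dbarPairing a b c i j χ) 2 := by
  have h0 := fun z => dbarCoord_eq_zero_of_notMem_tsupport (p := χ) (z := z)
  exact ((ha.memLp_mul hχ.2.1 hχ.2.2 (continuous_dbarCoord hχ.1 i) fun z hz => h0 z hz i).add
    (hb.memLp_mul hχ.2.1 hχ.2.2 (continuous_dbarCoord hχ.1 j) fun z hz => h0 z hz j)).add
    (hc.memLp_mul hχ.2.1 hχ.2.2 hχ.1.continuous fun z hz => image_eq_zero_of_notMem_tsupport hz)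

lemma dbarPairing_eq_zero_of_notMem_tsupport {a b c χ : (Fin n → ℂ) → ℂ} {z : Fin n → ℂ}
    (hz : z ∉ tsupport χ) (i j : Fin n) : dbarPairing a b c i j χ z = 0 := by
  simp [dbarPairing, dbarCoord_eq_zero_of_notMem_tsupport hz, image_eq_zero_of_notMem_tsupport hz]

lemma LocallyL2On.integrable_dbarPairing {D : Set (Fin n → ℂ)} {a b c χ : (Fin n → ℂ) → ℂ}
    (ha : LocallyL2On D a) (hb : LocallyL2On D b) (hc : LocallyL2On D c) (i j : Fin n)
    (hχ : IsTestFunOn D χ) : Integrable (dbarPairing a b c i j χ) := by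
  have : IsFiniteMeasure ((volume : Measure (Fin n → ℂ)).restrict (tsupport χ)) :=
    ⟨by simpa using IsCompact.measure_lt_top hχ.2.1⟩
  refine IntegrableOn.integrable_of_forall_notMem_eq_zero (s := tsupport χ) ?_ fun z hz =>
    dbarPairing_eq_zero_of_notMem_tsupport hz i j
  exact ((ha.memLp_dbarPairing hb hc i j hχ).restrict _).integrable (by norm_num)

/-- A quantitative Cauchy–Schwarz inequality. -/
lemma norm_integral_mul_le_of_integral_sq_le {α : Type*} [MeasurableSpace α] {ν : Measure α}
    {s h : α → ℂ} (hs : MemLp s 2 ν) (hh : MemLp h 2 ν) {t : ℝ} (ht : 0 < t)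
    (hst : ∫ z, ‖s z‖ ^ 2 ∂ν ≤ t ^ 2) :
    ‖∫ z, s z * h z ∂ν‖ ≤ t / 2 * (1 + ∫ z, ‖h z‖ ^ 2 ∂ν) := by
  have hs2 := (memLp_two_iff_integrable_sq_norm hs.1).1 hs
  have hh2 := (memLp_two_iff_integrable_sq_norm hh.1).1 hh
  have hI := (hs2.const_mul (1 / (2 * t))).add (hh2.const_mul (t / 2))
  refine (norm_integral_le_of_norm_le hI (ae_of_all _ fun z => ?_)).trans ?_
  · rw [norm_mul, Pi.add_apply]
    have : 1 / (2 * t) * ‖s z‖ ^ 2 + t / 2 * ‖h z‖ ^ 2 - ‖s z‖ * ‖h z‖ =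
        1 / (2 * t) * (‖s z‖ - t * ‖h z‖) ^ 2 := by field_simp; ring
    have h2 : 0 ≤ 1 / (2 * t) * (‖s z‖ - t * ‖h z‖) ^ 2 := by positivity
    linarith
  · simp only [Pi.add_apply]
    rw [integral_add (hs2.const_mul _) (hh2.const_mul _), integral_const_mul, integral_const_mul]
    have : 1 / (2 * t) * ∫ z, ‖s z‖ ^ 2 ∂ν ≤ 1 / (2 * t) * t ^ 2 := by gcongr
    have h2 : 1 / (2 * t) * t ^ 2 = t / 2 := by field_simp
    linarith

lemma memLp_restrict_ball_of_continuous {k : (Fin n → ℂ) → ℂ} (hk : Continuous k)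
    (x : Fin n → ℂ) (ρ : ℝ) : MemLp k 2 (volume.restrict (Metric.ball x ρ)) := by
  refine (memLp_two_iff_integrable_sq_norm hk.aestronglyMeasurable).2 ?_
  exact ((hk.norm.pow 2).continuousOn.integrableOn_compact (isCompact_closedBall x ρ)).mono_set
    Metric.ball_subset_closedBall

/-- Relatively closed pluripolar sets are locally removable for first-order `∂̄`-equations with
locally square integrable coefficients. -/
lemma PluripolarIn.exists_ball_integral_dbarPairing_eq_zero {D₁ D₂ E : Set (Fin n → ℂ)}
    (hEclosed : closure E ∩ D₂ ⊆ E) (hEpp : PluripolarIn E D₂) (hcover : D₂ = D₁ ∪ E)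
    {a b c : (Fin n → ℂ) → ℂ} (ha : LocallyL2On D₂ a) (hb : LocallyL2On D₂ b)
    (hc : LocallyL2On D₂ c) (i j : Fin n)
    (h : ∀ χ, IsTestFunOn D₁ χ → ∫ z in D₂, dbarPairing a b c i j χ z = 0)
    {x : Fin n → ℂ} (hx : x ∈ D₂) :
    ∃ ρ > 0, Metric.ball x ρ ⊆ D₂ ∧ ∀ χ, IsTestFunOn (Metric.ball x ρ) χ →
      ∫ z in D₂, dbarPairing a b c i j χ z = 0 := by
  obtain ⟨ρ, hρ, hρD, -, hcut⟩ := hEpp.exists_cutoff hx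
  refine ⟨ρ, hρ, hρD, fun χ hχV => ?_⟩
  set V := Metric.ball x ρ
  have hχ : IsTestFunOn D₂ χ := hχV.mono hρD
  have hD₂ : MeasurableSet D₂ := by
    have hopen : IsOpen D₂ := by
      refine isOpen_iff_mem_nhds.2 fun y hy => ?_
      obtain ⟨U, hU, -, hyU, hUD, -⟩ := hEpp y hy
      exact mem_of_superset (hU.mem_nhds hyU) hUD
    exact hopen.measurableSet
  have hVint : ∀ χ', tsupport χ' ⊆ V →
      ∫ z in D₂, dbarPairing a b c i j χ' z = ∫ z in V, dbarPairing a b c i j χ' z := by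
    intro χ' hχ'
    exact setIntegral_eq_of_subset_of_forall_sdiff_eq_zero hD₂ hρD fun z hz =>
      dbarPairing_eq_zero_of_notMem_tsupport (fun hz' => hz.2 (hχ' hz')) i j
  have hS : IsCompact (E ∩ tsupport χ) := by
    refine IsCompact.of_isClosed_subset hχ.2.1 (isClosed_of_closure_subset fun z hz => ?_)
      Set.inter_subset_right
    have hzχ : z ∈ tsupport χ :=
      (isClosed_tsupport χ).closure_subset_iff.2 Set.inter_subset_right hz
    exact ⟨hEclosed ⟨closure_mono Set.inter_subset_left hz, hχ.2.2 hzχ⟩, hzχ⟩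
  set P := dbarPairing a b c i j χ
  have hP : MemLp P 2 (volume.restrict V) := (ha.memLp_dbarPairing hb hc i j hχ).restrict _
  have haχ : MemLp (fun z => a z * χ z) 2 (volume.restrict V) :=
    (ha.memLp_mul hχ.2.1 hχ.2.2 hχ.1.continuous fun z hz =>
      image_eq_zero_of_notMem_tsupport hz).restrict _
  have hbχ : MemLp (fun z => b z * χ z) 2 (volume.restrict V) :=
    (hb.memLp_mul hχ.2.1 hχ.2.2 hχ.1.continuous fun z hz =>
      image_eq_zero_of_notMem_tsupport hz).restrict _
  set A : ℝ := (1 + ∫ z in V, ‖P z‖ ^ 2) + (1 + ∫ z in V, ‖a z * χ z‖ ^ 2) +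
    (1 + ∫ z in V, ‖b z * χ z‖ ^ 2)
  have hsmall : ∀ t > 0, ‖∫ z in D₂, P z‖ ≤ t / 2 * A := by
    intro t ht
    obtain ⟨g, hg, hg01, hgS, hgint, hgD⟩ := hcut _ hS (fun z hz => ⟨hz.1, hχV.2.2 hz.2⟩)
      (t ^ 2) (by positivity)
    have hgdiff : Differentiable ℝ g := hg.differentiable (by simp)
    have hgC : ContDiff ℝ (⊤ : ℕ∞) fun z => (g z : ℂ) := Complex.ofRealCLM.contDiff.comp hg
    have hgCdiff := hgC.differentiable (by simp)
    have hDcont : Continuous (fderiv ℝ g) := hg.continuous_fderiv (by simp)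
    have hcontI : ∀ {k : (Fin n → ℂ) → ℝ}, Continuous k → IntegrableOn k V volume := fun hk =>
      (hk.continuousOn.integrableOn_compact (isCompact_closedBall x ρ)).mono_set
        Metric.ball_subset_closedBall
    have hgsq : ∫ z in V, ‖(g z : ℂ)‖ ^ 2 ≤ t ^ 2 := by
      refine (integral_mono (hcontI ?_) (hcontI hg.continuous) fun z => ?_).trans hgint
      · exact (hgC.continuous.norm.pow 2)
      · simp only [Complex.norm_real, Real.norm_eq_abs, sq_abs]
        nlinarith [(hg01 z).1, (hg01 z).2]
    have hdbar : ∀ l : Fin n, ∫ z in V, ‖dbarCoord (fun y => (g y : ℂ)) l z‖ ^ 2 ≤ t ^ 2 := by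
      intro l
      simp_rw [norm_sq_dbarCoord_ofReal (hgdiff _) l]
      have hI : ∀ e, IntegrableOn (fun z => (fderiv ℝ g z e) ^ 2) V volume := fun e =>
        hcontI ((hDcont.clm_apply continuous_const).pow 2)
      rw [integral_const_mul, integral_add (hI _) (hI _)]
      have hs : ∀ w : ℂ, ‖w‖ ≤ 1 → ‖(Pi.single l w : Fin n → ℂ)‖ ≤ 1 := fun w hw =>
        (pi_norm_le_iff_of_nonneg zero_le_one).2 fun k => by
          rcases eq_or_ne k l with rfl | hk
          · simpa using hw
          · simp [hk]
      have h1 := hgD (Pi.single l 1) (hs _ (by simp))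
      have h2 := hgD (Pi.single l Complex.I) (hs _ (by simp))
      linarith [sq_nonneg t]
    have hχ' : IsTestFunOn D₁ fun z => (1 - (g z : ℂ)) * χ z := by
      refine ⟨(contDiff_const.sub hgC).mul hχ.1, hχ.2.1.mul_left, fun z hz => ?_⟩
      have hzχ : z ∈ tsupport χ := tsupport_mul_subset_right hz
      by_contra hzD
      have hzE : z ∈ E := (hcover ▸ hχ.2.2 hzχ : z ∈ D₁ ∪ E).resolve_left hzD
      have h1 : ∀ᶠ y in 𝓝 z, g y = 1 :=
        hgS.filter_mono (nhds_le_nhdsSet (show z ∈ E ∩ tsupport χ from ⟨hzE, hzχ⟩))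
      refine notMem_tsupport_iff_eventuallyEq.2 ?_ hz
      filter_upwards [h1] with y hy
      simp [hy]
    have hgχ : IsTestFunOn D₂ fun z => (g z : ℂ) * χ z := hχ.mul_left hgC
    have hsplit : ∫ z in D₂, P z =
        ∫ z in D₂, dbarPairing a b c i j (fun y => (g y : ℂ) * χ y) z := by
      have hsum : P = fun z => dbarPairing a b c i j (fun y => (1 - (g y : ℂ)) * χ y) z +
          dbarPairing a b c i j (fun y => (g y : ℂ) * χ y) z := by
        funext z
        have e : (fun y => (1 - (g y : ℂ)) * χ y + (g y : ℂ) * χ y) = χ := by funext y; ring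
        rw [← dbarPairing_add i j hχ'.differentiable hgχ.differentiable, e]
      rw [hsum, integral_add
        (ha.integrable_dbarPairing hb hc i j
          (hχ.mul_left (contDiff_const.sub hgC))).integrableOn
        (ha.integrable_dbarPairing hb hc i j hgχ).integrableOn, h _ hχ', zero_add]
    have m1 : MemLp _ 2 (volume.restrict V) :=
      memLp_restrict_ball_of_continuous hgC.continuous x ρ
    have m2 : ∀ l, MemLp _ 2 (volume.restrict V) := fun l =>
      memLp_restrict_ball_of_continuous (continuous_dbarCoord hgC l) x ρ
    have I1 : Integrable (fun z => (g z : ℂ) * P z) (volume.restrict V) := m1.integrable_mul hP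
    have I2 : Integrable (fun z => dbarCoord (fun y => (g y : ℂ)) i z * (a z * χ z))
      (volume.restrict V) := (m2 i).integrable_mul haχ
    have I3 : Integrable (fun z => dbarCoord (fun y => (g y : ℂ)) j z * (b z * χ z))
      (volume.restrict V) := (m2 j).integrable_mul hbχ
    have I12 : Integrable (fun z => (g z : ℂ) * P z +
      dbarCoord (fun y => (g y : ℂ)) i z * (a z * χ z)) (volume.restrict V) := I1.add I2
    rw [hsplit, hVint _ (tsupport_mul_subset_right.trans hχV.2.2)]
    simp_rw [dbarPairing_mul i j hgCdiff hχ.differentiable]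
    rw [integral_add I12 I3, integral_add I1 I2]
    have b1 := norm_integral_mul_le_of_integral_sq_le m1 hP ht hgsq
    have b2 := norm_integral_mul_le_of_integral_sq_le (m2 i) haχ ht (hdbar i)
    have b3 := norm_integral_mul_le_of_integral_sq_le (m2 j) hbχ ht (hdbar j)
    refine (norm_add₃_le).trans ?_
    simp only [A]
    linarith
  have hlim : Tendsto (fun t : ℝ => t / 2 * A) (𝓝[>] 0) (𝓝 0) := by
    have : Tendsto (fun t : ℝ => t / 2 * A) (𝓝 0) (𝓝 (0 / 2 * A)) :=
      (Continuous.tendsto (by fun_prop) 0)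
    simpa using this.mono_left nhdsWithin_le_nhds
  have := ge_of_tendsto hlim (by filter_upwards [self_mem_nhdsWithin] with t ht using hsmall t ht)
  exact norm_le_zero_iff.1 this

/-- Relatively closed pluripolar sets are removable for first-order `∂̄`-equations with locally
square integrable coefficients. -/
lemma PluripolarIn.integral_dbarPairing_eq_zero {D₁ D₂ E : Set (Fin n → ℂ)}
    (hEclosed : closure E ∩ D₂ ⊆ E) (hEpp : PluripolarIn E D₂) (hcover : D₂ = D₁ ∪ E)
    {a b c : (Fin n → ℂ) → ℂ} (ha : LocallyL2On D₂ a) (hb : LocallyL2On D₂ b)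
    (hc : LocallyL2On D₂ c) (i j : Fin n)
    (h : ∀ χ, IsTestFunOn D₁ χ → ∫ z in D₂, dbarPairing a b c i j χ z = 0)
    {χ : (Fin n → ℂ) → ℂ} (hχ : IsTestFunOn D₂ χ) :
    ∫ z in D₂, dbarPairing a b c i j χ z = 0 := by
  obtain ⟨η, -, hη1, hη⟩ : ∃ η : (Fin n → ℂ) → ℂ, ContDiff ℝ (⊤ : ℕ∞) η ∧
      (∀ z ∈ tsupport χ, η z = 1) ∧ ∀ χ', IsTestFunOn D₂ χ' →
        ∫ z in D₂, dbarPairing a b c i j (fun y => η y * χ' y) z = 0 := by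
    refine IsCompact.induction_on (s := tsupport χ) hχ.2.1 (p := fun S => ∃ η : (Fin n → ℂ) → ℂ,
      ContDiff ℝ (⊤ : ℕ∞) η ∧ (∀ z ∈ S, η z = 1) ∧ ∀ χ', IsTestFunOn D₂ χ' →
        ∫ z in D₂, dbarPairing a b c i j (fun y => η y * χ' y) z = 0) ?_ ?_ ?_ ?_
    · refine ⟨fun _ => 0, contDiff_const, by simp, fun χ' _ => ?_⟩
      simp [dbarPairing, dbarCoord]
    · rintro S T hST ⟨η, h1, h2, h3⟩
      exact ⟨η, h1, fun z hz => h2 z (hST hz), h3⟩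
    · rintro S T ⟨η, h1, h2, h3⟩ ⟨θ, k1, k2, k3⟩
      refine ⟨fun z => η z + (1 - η z) * θ z, h1.add ((contDiff_const.sub h1).mul k1), ?_,
        fun χ' hχ' => ?_⟩
      · rintro z (hz | hz)
        · simp [h2 z hz]
        · simp [k2 z hz]
      · have e1 : (fun y => (η y + (1 - η y) * θ y) * χ' y) =
            fun y => η y * χ' y + θ y * ((1 - η y) * χ' y) := by funext y; ring
        have t1 := hχ'.mul_left (contDiff_const.sub h1 : ContDiff ℝ _ fun y => 1 - η y)
        have t2 := t1.mul_left k1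
        have t3 := hχ'.mul_left h1
        simp_rw [e1, dbarPairing_add i j t3.differentiable t2.differentiable]
        rw [integral_add (ha.integrable_dbarPairing hb hc i j t3).integrableOn
          (ha.integrable_dbarPairing hb hc i j t2).integrableOn, h3 _ hχ', k3 _ t1, add_zero]
    · intro x hx
      obtain ⟨ρ, hρ, -, hz⟩ := hEpp.exists_ball_integral_dbarPairing_eq_zero hEclosed hcover
        ha hb hc i j h (hχ.2.2 hx)
      let θ : ContDiffBump x := ⟨ρ / 4, ρ / 2, by linarith, by linarith⟩
      have hθ : ContDiff ℝ (⊤ : ℕ∞) fun z => (θ z : ℂ) :=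
        Complex.ofRealCLM.contDiff.comp θ.contDiff
      refine ⟨Metric.closedBall x (ρ / 4), mem_nhdsWithin_of_mem_nhds
        (Metric.closedBall_mem_nhds x (by linarith)), fun z => (θ z : ℂ), hθ, fun z hz => ?_,
        fun χ' hχ' => hz _ ⟨hθ.mul hχ'.1, hχ'.2.1.mul_left, ?_⟩⟩
      · simp [θ.one_of_mem_closedBall hz]
      · refine tsupport_mul_subset_left.trans ?_
        have h1 : tsupport (fun z => (θ z : ℂ)) ⊆ tsupport θ :=
          closure_mono fun z hz => by simpa using hz
        refine h1.trans ?_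
        rw [θ.tsupport_eq]
        exact Metric.closedBall_subset_ball (by change ρ / 2 < ρ; linarith)
  have heq : (fun y => η y * χ y) = χ := by
    funext y
    by_cases hy : y ∈ tsupport χ
    · rw [hη1 y hy, one_mul]
    · rw [image_eq_zero_of_notMem_tsupport hy, mul_zero]
  simpa [heq] using hη χ hχ

/-- A relatively closed pluripolar set is Lebesgue null. -/
lemma PluripolarIn.volume_eq_zero {E Ω : Set (Fin n → ℂ)} (hE : PluripolarIn E Ω)
    (hsub : E ⊆ Ω) : volume E = 0 := by
  refine measure_null_of_locally_null E fun x hx => ?_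
  obtain ⟨ρ, hρ, -, h0, -⟩ := hE.exists_cutoff (hsub hx)
  exact ⟨_, inter_mem_nhdsWithin E (Metric.ball_mem_nhds x hρ), h0⟩

end Removability

section Optimal

variable {n : ℕ}

/-- Weighted square integrability with an upper semicontinuous weight implies local square
integrability. -/
lemma LocallyL2On.of_eL2_lt_top {D : Set (Fin n → ℂ)} {φ ψ : (Fin n → ℂ) → ℝ}
    (hφ : Continuous φ) (hψ : UpperSemicontinuousOn ψ D) {u : (Fin n → ℂ) → ℂ} (hu : Measurable u)
    (h : eL2 D (fun z => φ z + ψ z) u < ⊤) : LocallyL2On D u := by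
  intro K hK hKD
  obtain ⟨M₁, hM₁⟩ := hK.bddAbove_image hφ.continuousOn
  obtain ⟨M₂, hM₂⟩ := (hψ.mono hKD).bddAbove_of_isCompact hK
  refine (memLp_two_iff_integrable_sq_norm hu.aestronglyMeasurable).2
    ⟨(hu.norm.pow_const 2).aestronglyMeasurable, ?_⟩
  rw [hasFiniteIntegral_iff_ofReal (ae_of_all _ fun z => by positivity)]
  calc ∫⁻ z in K, ENNReal.ofReal (‖u z‖ ^ 2)
      ≤ ∫⁻ z in K, ENNReal.ofReal (Real.exp (M₁ + M₂)) *
          ENNReal.ofReal (‖u z‖ ^ 2 * Real.exp (-(φ z + ψ z))) := by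
        refine setLIntegral_mono' hK.isClosed.measurableSet fun z hz => ?_
        rw [← ENNReal.ofReal_mul (Real.exp_pos _).le]
        refine ENNReal.ofReal_le_ofReal ?_
        have h1 : φ z ≤ M₁ := hM₁ ⟨z, hz, rfl⟩
        have h2 : ψ z ≤ M₂ := hM₂ ⟨z, hz, rfl⟩
        have h3 : 1 ≤ Real.exp (M₁ + M₂) * Real.exp (-(φ z + ψ z)) := by
          rw [← Real.exp_add]
          exact Real.one_le_exp (by linarith)
        nlinarith [sq_nonneg ‖u z‖]
    _ = ENNReal.ofReal (Real.exp (M₁ + M₂)) *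
          ∫⁻ z in K, ENNReal.ofReal (‖u z‖ ^ 2 * Real.exp (-(φ z + ψ z))) :=
        lintegral_const_mul' _ _ ENNReal.ofReal_ne_top
    _ ≤ ENNReal.ofReal (Real.exp (M₁ + M₂)) * eL2 D (fun z => φ z + ψ z) u := by
        gcongr
        exact lintegral_mono_set hKD
    _ < ⊤ := ENNReal.mul_lt_top ENNReal.ofReal_lt_top h

lemma eL2_le_eL2form (D : Set (Fin n → ℂ)) (w : (Fin n → ℂ) → ℝ)
    (f : Fin n → (Fin n → ℂ) → ℂ) (j : Fin n) : eL2 D w (f j) ≤ eL2form D w f := by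
  refine lintegral_mono fun z => ENNReal.ofReal_le_ofReal ?_
  gcongr
  exact Finset.single_le_sum (f := fun i => ‖f i z‖ ^ 2) (fun i _ => sq_nonneg _)
    (Finset.mem_univ j)

lemma locallyL2On_zero (D : Set (Fin n → ℂ)) : LocallyL2On D fun _ => 0 :=
  fun _ _ _ => MemLp.zero

lemma dbarClosedOn_iff_of_pluripolar_diff {D₁ D₂ E : Set (Fin n → ℂ)} (hsub : D₁ ⊆ D₂)
    (hEclosed : closure E ∩ D₂ ⊆ E) (hEpp : PluripolarIn E D₂) (hcover : D₂ = D₁ ∪ E)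
    (hvol : (volume : Measure (Fin n → ℂ)).restrict D₁ = volume.restrict D₂)
    {f : Fin n → (Fin n → ℂ) → ℂ} (hf : ∀ j, LocallyL2On D₂ (f j)) :
    DbarClosedOn D₁ f ↔ DbarClosedOn D₂ f := by
  unfold DbarClosedOn
  rw [hvol]
  refine ⟨fun h i j χ hχ => ?_, fun h i j χ hχ => h i j χ (hχ.mono hsub)⟩
  have hpair : ∀ χ z, dbarPairing (f i) (fun z => -f j z) (fun _ => 0) j i χ z =
      f i z * dbarCoord χ j z - f j z * dbarCoord χ i z := fun χ z => by
    simp only [dbarPairing]; ring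
  have hneg : LocallyL2On D₂ fun z => -f j z := fun K hK hKD => (hf j K hK hKD).neg
  have := hEpp.integral_dbarPairing_eq_zero hEclosed hcover (hf i) hneg (locallyL2On_zero D₂) j i
    (fun χ hχ => by simpa only [hpair] using h i j χ hχ) hχ
  simpa only [hpair] using this

lemma dbarEqOn_iff_of_pluripolar_diff {D₁ D₂ E : Set (Fin n → ℂ)} (hsub : D₁ ⊆ D₂)
    (hEclosed : closure E ∩ D₂ ⊆ E) (hEpp : PluripolarIn E D₂) (hcover : D₂ = D₁ ∪ E)
    (hvol : (volume : Measure (Fin n → ℂ)).restrict D₁ = volume.restrict D₂)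
    {u : (Fin n → ℂ) → ℂ} {f : Fin n → (Fin n → ℂ) → ℂ} (hu : LocallyL2On D₂ u)
    (hf : ∀ j, LocallyL2On D₂ (f j)) : DbarEqOn D₁ u f ↔ DbarEqOn D₂ u f := by
  unfold DbarEqOn
  rw [hvol]
  refine ⟨fun h j χ hχ => ?_, fun h j χ hχ => h j χ (hχ.mono hsub)⟩
  have hz := locallyL2On_zero D₂
  have hpair : ∀ χ, IsTestFunOn D₂ χ →
      ∫ z in D₂, dbarPairing u (fun _ => 0) (f j) j j χ z =
        (∫ z in D₂, u z * dbarCoord χ j z) + ∫ z in D₂, f j z * χ z := by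
    intro χ hχ
    have i1 : Integrable fun z => u z * dbarCoord χ j z := by
      refine (hu.integrable_dbarPairing hz hz j j hχ).congr (ae_of_all _ fun z => ?_)
      simp [dbarPairing]
    have i2 : Integrable fun z => f j z * χ z := by
      refine (hz.integrable_dbarPairing hz (hf j) j j hχ).congr (ae_of_all _ fun z => ?_)
      simp [dbarPairing]
    rw [← integral_add i1.integrableOn i2.integrableOn]
    simp [dbarPairing]
  have := hEpp.integral_dbarPairing_eq_zero hEclosed hcover hu hz (hf j) j j
    (fun χ hχ => by rw [hpair χ (hχ.mono hsub), h j χ hχ, neg_add_cancel]) hχ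
  rw [hpair χ hχ] at this
  exact eq_neg_of_add_eq_zero_left this

end Optimal

/-- Proposition 4.4: if `D₂ = D₁ ∪ E` for domains `D₁ ⊆ D₂ ⊆ ℂⁿ` with
`E` closed in `D₂` and pluripolar in `D₂`, and `ψ` is upper semicontinuous on `D₂`, then
`(D₁, ψ)` is `L²`-optimal iff `(D₂, ψ)` is `L²`-optimal. -/
theorem l2OptimalPair_iff_of_pluripolar_diff {n : ℕ} (D₁ D₂ : Set (Fin n → ℂ))
    (hOpen₁ : IsOpen D₁) (hConn₁ : IsConnected D₁)
    (hOpen₂ : IsOpen D₂) (hConn₂ : IsConnected D₂) (hsub : D₁ ⊆ D₂)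
    (ψ : (Fin n → ℂ) → ℝ) (hψ : UpperSemicontinuousOn ψ D₂)
    (E : Set (Fin n → ℂ)) (hE : E ⊆ D₂) (hEclosed : closure E ∩ D₂ ⊆ E)
    (hEpp : PluripolarIn E D₂) (hcover : D₂ = D₁ ∪ E) :
    L2OptimalPair D₁ ψ ↔ L2OptimalPair D₂ ψ := by
  have hEnull : volume E = 0 := hEpp.volume_eq_zero hE
  have hvol : (volume : Measure (Fin n → ℂ)).restrict D₁ = volume.restrict D₂ := by
    rw [hcover]
    exact Measure.restrict_congr_set (union_ae_eq_left_of_ae_eq_empty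
      (ae_eq_empty.2 hEnull)).symm
  have hL2 : ∀ w u, eL2 D₁ w u = eL2 D₂ w u := fun w u => by rw [eL2, eL2, hvol]
  have hL2form : ∀ w f, eL2form D₁ w f = eL2form D₂ w f := fun w f => by
    rw [eL2form, eL2form, hvol]
  refine forall_congr' fun φ => forall_congr' fun hφ => forall_congr' fun f =>
    forall_congr' fun hf => ?_
  rw [hL2form, hvol]
  refine forall_congr' fun hfL2 => ?_
  have hfloc : ∀ j, LocallyL2On D₂ (f j) := fun j =>
    .of_eL2_lt_top hφ.1.continuous hψ (hf j) ((eL2_le_eL2form _ _ _ _).trans_lt hfL2)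
  rw [dbarClosedOn_iff_of_pluripolar_diff hsub hEclosed hEpp hcover hvol hfloc]
  refine forall_congr' fun _ => forall_congr' fun hfin => exists_congr fun u =>
    and_congr_right fun hu => ?_
  rw [hL2]
  refine and_congr_left fun hle => ?_
  exact dbarEqOn_iff_of_pluripolar_diff hsub hEclosed hEpp hcover hvol
    (.of_eL2_lt_top hφ.1.continuous hψ hu (hle.trans_lt hfin)) hfloc

end
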